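/- Let η > 0 and δ > 0 satisfy K/(R(d−1)) − (R+1) > δ/η. Then there is a constant c depending only on n, R, d, η, δ (not on C̃, ν or P) such that for all τ ≥ 0, all P ≥ 1 and all ν ∈ ℤ^R: Σ_{q > P^{τη}} Σ_{a mod q, gcd(a_1,…,a_R,q)=1} q^{−n} |S_{a,q}(ν)| ≤ c C̃^{K/(d−1)} P^{−τδ}. -/

import Mathlib

open MeasureTheory Filter MvPolynomial

noncomputable section

/-- `e t = exp (2 π i t)` -/
def eC (t : ℝ) : ℂ := Complex.exp (2 * (Real.pi : ℂ) * Complex.I * (t : ℂ))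

abbrev Qbar : Type := AlgebraicClosure ℚ

/-- Dimension of the affine singular locus of `g` (the common zero set of the partial
derivatives of `g`), as the Krull dimension of its coordinate ring. -/
def singDim (n : ℕ) (g : MvPolynomial (Fin n) Qbar) : WithBot ℕ∞ :=
  ringKrullDim (MvPolynomial (Fin n) Qbar ⧸
    Ideal.span (Set.range fun j : Fin n => MvPolynomial.pderiv j g))

/-- `Δ = max_{b ∈ ℤ^R \ {0}} dim Sing(b₁ g₁ + ⋯ + b_R g_R)`. -/
def birchDelta (n R : ℕ) (g : Fin R → MvPolynomial (Fin n) ℤ) : WithBot ℕ∞ :=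
  ⨆ (b : Fin R → ℤ) (_ : b ≠ 0),
    singDim n (MvPolynomial.map (Int.castRingHom Qbar) (∑ i, b i • g i))

/-- `K = (n - Δ)/2^(d-1)` where `Δ = max_{b ≠ 0} dim Sing(f̃_b)`. -/
def KofDelta (n R d : ℕ) (g : Fin R → MvPolynomial (Fin n) ℤ) (K : ℝ) : Prop :=
  ∃ Δ : ℕ, ((Δ : ℕ∞) : WithBot ℕ∞) = birchDelta n R g ∧
    K = ((n : ℝ) - (Δ : ℝ)) / 2 ^ (d - 1)

/-- The quantity `R(R+1)(d-1)` as a real number. -/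
def BB (R d : ℕ) : ℝ := (R : ℝ) * ((R : ℝ) + 1) * ((d : ℝ) - 1)

/-- The `R × R` minor of the Jacobian matrix of `f` with columns given by the elements
of `I`. -/
def jacMinor {n R : ℕ} (f : Fin R → MvPolynomial (Fin n) ℤ)
    (I : Finset (Fin n)) (hI : I.card = R) : MvPolynomial (Fin n) ℤ :=
  Matrix.det (Matrix.of fun i k : Fin R => MvPolynomial.pderiv (I.orderEmbOfFin hI k) (f i))

/-- `Cv` is the maximum of the absolute values of the coefficients of the `f i`. -/
def coeffMax {n R : ℕ} (f : Fin R → MvPolynomial (Fin n) ℤ) (Cv : ℝ) : Prop :=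
  IsGreatest {x : ℝ | ∃ (i : Fin R) (m : (Fin n) →₀ ℕ), x = |((MvPolynomial.coeff m (f i) : ℤ) : ℝ)|} Cv

/-- The integer points of the dilated box `P𝓑`. -/
def boxPts {n : ℕ} (aB bB : Fin n → ℝ) (P : ℝ) : Finset (Fin n → ℤ) :=
  Finset.Icc (fun j => ⌈P * aB j⌉) (fun j => ⌊P * bB j⌋)

/-- The exponential sum `S(α) = ∑_{x ∈ P𝓑 ∩ ℤ^n} e(α · f(x))`. -/
def Sexp {n R : ℕ} (f : Fin R → MvPolynomial (Fin n) ℤ) (aB bB : Fin n → ℝ) (P : ℝ)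
    (α : Fin R → ℝ) : ℂ :=
  ∑ x ∈ boxPts aB bB P, eC (∑ i, α i * (MvPolynomial.eval x (f i) : ℝ))

/-- The complete exponential sum `S_{a,q} = ∑_{x mod q} e(a · f(x)/q)`. -/
def Sgauss {n R : ℕ} (f : Fin R → MvPolynomial (Fin n) ℤ) (q : ℕ) (a : Fin R → ℤ) : ℂ :=
  ∑ x : Fin n → Fin q,
    eC ((∑ i, (a i : ℝ) * (MvPolynomial.eval (fun j => ((x j : ℕ) : ℤ)) (f i) : ℝ)) / q)

/-- `S_{a,q}(ν) = S_{a,q} e(-a·ν/q)`. -/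
def SgaussNu {n R : ℕ} (f : Fin R → MvPolynomial (Fin n) ℤ) (q : ℕ) (a : Fin R → ℤ)
    (ν : Fin R → ℤ) : ℂ :=
  Sgauss f q a * eC (-(∑ i, (a i : ℝ) * (ν i : ℝ)) / q)

/-- Residues `1 ≤ aᵢ ≤ q` (coded by `Fin q`, shifted by one) with `gcd(a₁, …, a_R, s) = 1`. -/
def resSet (R q s : ℕ) : Finset (Fin R → Fin q) :=
  Finset.univ.filter fun a => Nat.gcd (Finset.univ.gcd fun i => (a i : ℕ) + 1) s = 1

/-- The singular series `𝔖(ν)`. -/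
def singularSeries {n R : ℕ} (f : Fin R → MvPolynomial (Fin n) ℤ) (ν : Fin R → ℤ) : ℂ :=
  ∑' q : ℕ, ((q : ℂ) ^ n)⁻¹ *
    ∑ a ∈ resSet R q q, SgaussNu f q (fun i => ((a i : ℕ) : ℤ) + 1) ν

/-- The local density `𝔖_p(ν)`. -/
def localDensity {n R : ℕ} (f : Fin R → MvPolynomial (Fin n) ℤ) (ν : Fin R → ℤ) (p : ℕ) : ℂ :=
  ∑' r : ℕ, ((p : ℂ) ^ (r * n))⁻¹ *
    ∑ a ∈ resSet R (p ^ r) p, SgaussNu f (p ^ r) (fun i => ((a i : ℕ) : ℤ) + 1) ν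

/-- The box `𝓑 = ∏ⱼ [aⱼ, bⱼ]` as a subset of `ℝ^n`. -/
def boxSet {n : ℕ} (aB bB : Fin n → ℝ) : Set (Fin n → ℝ) :=
  Set.univ.pi fun j => Set.Icc (aB j) (bB j)

/-- The oscillatory integral `I(𝓒, γ) = ∫_{ζ ∈ 𝓒} e(γ · g(ζ)) dζ`. -/
def Iosc {n R : ℕ} (g : Fin R → MvPolynomial (Fin n) ℤ) (C : Set (Fin n → ℝ))
    (γ : Fin R → ℝ) : ℂ :=
  ∫ ζ in C, eC (∑ i, γ i * MvPolynomial.aeval ζ (g i))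

/-- `J(μ, Φ) = ∫_{|γ| ≤ Φ} I(𝓑, γ) e(-γ·μ) dγ`. -/
def Jint {n R : ℕ} (g : Fin R → MvPolynomial (Fin n) ℤ) (aB bB : Fin n → ℝ)
    (μ : Fin R → ℝ) (Φ : ℝ) : ℂ :=
  ∫ γ in {γ : Fin R → ℝ | ∀ i, |γ i| ≤ Φ}, Iosc g (boxSet aB bB) γ * eC (-(∑ i, γ i * μ i))

/-- The singular integral `J(μ) = lim_{Φ → ∞} J(μ, Φ)`. -/
def Jlim {n R : ℕ} (g : Fin R → MvPolynomial (Fin n) ℤ) (aB bB : Fin n → ℝ)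
    (μ : Fin R → ℝ) : ℂ :=
  limUnder Filter.atTop fun Φ : ℝ => Jint g aB bB μ Φ

/-- `M(P, ν)`: the number of integer points `x ∈ P𝓑` with `f(x) = ν`. -/
def Mcount {n R : ℕ} (f : Fin R → MvPolynomial (Fin n) ℤ) (aB bB : Fin n → ℝ) (P : ℝ)
    (ν : Fin R → ℤ) : ℕ :=
  ((boxPts aB bB P).filter fun x => ∀ i, MvPolynomial.eval x (f i) = ν i).card

/-- A single major arc `𝔐_{a,q}(θ)`. -/
def majorArc {R : ℕ} (d : ℕ) (Ct P θ : ℝ) (q : ℕ) (a : Fin R → ℤ) : Set (Fin R → ℝ) :=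
  Set.univ.pi fun i => Set.Icc
    ((a i : ℝ) / q - Ct ^ (R - 1) * P ^ (-(d : ℝ) + (R : ℝ) * ((d : ℝ) - 1) * θ) / (2 * q))
    ((a i : ℝ) / q + Ct ^ (R - 1) * P ^ (-(d : ℝ) + (R : ℝ) * ((d : ℝ) - 1) * θ) / (2 * q))

/-- The major arcs `𝔐(θ)`. -/
def majorArcs (R d : ℕ) (Ct P θ : ℝ) : Set (Fin R → ℝ) :=
  ⋃ (q : ℕ) (_ : 1 ≤ q ∧ (q : ℝ) ≤ Ct ^ R * P ^ ((R : ℝ) * ((d : ℝ) - 1) * θ))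
    (a : Fin R → ℤ)
    (_ : (∀ i, 1 ≤ a i ∧ a i ≤ (q : ℤ)) ∧ Int.gcd (Finset.univ.gcd a) (q : ℤ) = 1),
    majorArc d Ct P θ q a

/-- The minor arcs `𝔪 = [0,1]^R \ 𝔐(θ)`, taken modulo `1`. -/
def minorArcs (R d : ℕ) (Ct P θ : ℝ) : Set (Fin R → ℝ) :=
  {α | (∀ i, 0 ≤ α i ∧ α i ≤ 1) ∧
    ∀ z : Fin R → ℤ, (fun i => α i + (z i : ℝ)) ∉ majorArcs R d Ct P θ}

/-- Nonsingularity of the affine variety `f = 0` over `ℚ̄`: at every common zero the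
Jacobian matrix has (maximal) rank `R`, i.e. some `R × R` minor is nonvanishing. -/
def AffineNonsingular {n : ℕ} (R : ℕ) (f : Fin R → MvPolynomial (Fin n) ℤ) : Prop :=
  ∀ x : Fin n → Qbar, (∀ i, MvPolynomial.aeval x (f i) = 0) →
    ∃ (I : Finset (Fin n)) (hI : I.card = R), MvPolynomial.aeval x (jacMinor f I hI) ≠ 0

/-- Nonsingularity of the projective variety `g = 0` over `ℚ̄` (for forms `g`): at every
nonzero point of the affine cone the Jacobian matrix has rank `R`. -/
def ProjNonsingular {n : ℕ} (R : ℕ) (g : Fin R → MvPolynomial (Fin n) ℤ) : Prop :=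
  ∀ x : Fin n → Qbar, x ≠ 0 → (∀ i, MvPolynomial.aeval x (g i) = 0) →
    ∃ (I : Finset (Fin n)) (hI : I.card = R), MvPolynomial.aeval x (jacMinor g I hI) ≠ 0

/-! ### Part A: cutting a homogeneous ideal down to dimension zero -/

theorem SST_homComp_mul {κ k : Type*} [CommRing k] {g : MvPolynomial κ k} {e : ℕ}
    (hg : g.IsHomogeneous e) (p : MvPolynomial κ k) (i : ℕ) :
    homogeneousComponent (i + e) (g * p) = g * homogeneousComponent i p := by
  classical
  ext m
  rw [coeff_homogeneousComponent, coeff_mul, coeff_mul]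
  split_ifs with h
  · refine Finset.sum_congr rfl fun x hx => ?_
    rw [coeff_homogeneousComponent]
    by_cases h0 : coeff x.1 g = 0
    · simp [h0]
    have h1 : x.1.degree = e := by
      have := hg h0
      rw [Finsupp.degree_eq_weight_one]; exact this
    rw [Finset.HasAntidiagonal.mem_antidiagonal] at hx
    have h2 : x.2.degree = i := by
      rw [← hx, map_add, h1] at h
      omega
    simp [h2]
  · symm
    refine Finset.sum_eq_zero fun x hx => ?_
    rw [coeff_homogeneousComponent]
    by_cases h0 : coeff x.1 g = 0
    · simp [h0]
    have h1 : x.1.degree = e := by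
      have := hg h0
      rw [Finsupp.degree_eq_weight_one]; exact this
    rw [Finset.HasAntidiagonal.mem_antidiagonal] at hx
    have h2 : x.2.degree ≠ i := by
      rintro rfl
      apply h
      rw [← hx, map_add, h1, add_comm]
    simp [h2]

theorem SST_homComp_mul_lt {κ k : Type*} [CommRing k] {g : MvPolynomial κ k} {e : ℕ}
    (hg : g.IsHomogeneous e) (p : MvPolynomial κ k) (i : ℕ) (hi : i < e) :
    homogeneousComponent i (g * p) = 0 := by
  classical
  ext m
  rw [coeff_homogeneousComponent, coeff_mul]
  split_ifs with h
  · rw [coeff_zero]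
    refine Finset.sum_eq_zero fun x hx => ?_
    by_cases h0 : coeff x.1 g = 0
    · simp [h0]
    have h1 : x.1.degree = e := by
      have := hg h0
      rw [Finsupp.degree_eq_weight_one]; exact this
    rw [Finset.HasAntidiagonal.mem_antidiagonal] at hx
    rw [← hx, map_add, h1] at h
    omega
  · simp

/-- `I` is stable under taking homogeneous components. -/
def SSTHom {κ k : Type*} [CommRing k] (I : Ideal (MvPolynomial κ k)) : Prop :=
  ∀ p ∈ I, ∀ i, homogeneousComponent i p ∈ I

theorem SSTHom_span {κ k : Type*} [CommRing k] (s : Set (MvPolynomial κ k))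
    (hs : ∀ g ∈ s, ∃ e, g.IsHomogeneous e) : SSTHom (Ideal.span s) := by
  intro p hp
  induction hp using Submodule.span_induction with
  | zero => intro i; simp
  | add x y _ _ hx hy => intro i; rw [map_add]; exact add_mem (hx i) (hy i)
  | mem x hx =>
    intro i
    obtain ⟨e, he⟩ := hs x hx
    rw [homogeneousComponent_of_mem (he : x ∈ homogeneousSubmodule _ _ e)]
    split_ifs
    · exact Ideal.subset_span hx
    · simp
  | smul a x hx' hx =>
    intro i
    rw [smul_eq_mul]
    have : a * x = ∑ j ∈ Finset.range (x.totalDegree + 1), homogeneousComponent j x * a := by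
      rw [← Finset.sum_mul, sum_homogeneousComponent, mul_comm]
    rw [this, map_sum]
    refine sum_mem fun j _ => ?_
    have hh := homogeneousComponent_isHomogeneous j x
    rcases lt_or_ge i j with h | h
    · rw [SST_homComp_mul_lt hh _ _ h]; simp
    · obtain ⟨l, rfl⟩ := Nat.exists_eq_add_of_le h
      rw [add_comm, SST_homComp_mul hh]
      exact Ideal.mul_mem_right _ _ (hx j)

theorem SSTHom_sup {κ k : Type*} [CommRing k] {I J : Ideal (MvPolynomial κ k)}
    (hI : SSTHom I) (hJ : SSTHom J) : SSTHom (I ⊔ J) := by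
  intro p hp i
  obtain ⟨a, ha, b, hb, rfl⟩ := Submodule.mem_sup.mp hp
  rw [map_add]
  exact Submodule.add_mem_sup (hI a ha i) (hJ b hb i)

theorem SST_dimZero {n : ℕ} {k : Type*} [Field k] (I : Ideal (MvPolynomial (Fin n) k))
    (hI : SSTHom I) (hdim : ringKrullDim (MvPolynomial (Fin n) k ⧸ I) ≤ 0) :
    ∃ N : ℕ, ∀ i, (X i : MvPolynomial (Fin n) k) ^ N ∈ I := by
  have h0 : Ring.KrullDimLE 0 (MvPolynomial (Fin n) k ⧸ I) := by
    rw [Ring.krullDimLE_iff]; simpa using hdim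
  have hfin : Module.Finite k (MvPolynomial (Fin n) k ⧸ I) :=
    (Module.finite_iff_krullDimLE_zero k _).2 h0
  have key : ∀ i : Fin n, ∃ N : ℕ, (X i : MvPolynomial (Fin n) k) ^ N ∈ I := by
    intro i
    have hIntg : IsIntegral k (Ideal.Quotient.mk I (X i)) := IsIntegral.of_finite k _
    obtain ⟨P, hP, hP0⟩ := hIntg
    refine ⟨P.natDegree, ?_⟩
    have h1 : Polynomial.aeval (X i : MvPolynomial (Fin n) k) P ∈ I := by
      rw [← Ideal.Quotient.eq_zero_iff_mem, ← hP0, Polynomial.aeval_def, Polynomial.hom_eval₂]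
      rfl
    have h2 := hI _ h1 P.natDegree
    rw [Polynomial.aeval_eq_sum_range, map_sum, Finset.sum_eq_single P.natDegree] at h2
    · rw [LinearMap.map_smul, hP.coeff_natDegree, one_smul,
        homogeneousComponent_of_mem (isHomogeneous_X_pow i P.natDegree), if_pos rfl] at h2
      exact h2
    · intro b _ hb
      rw [LinearMap.map_smul, homogeneousComponent_of_mem (isHomogeneous_X_pow i b),
        if_neg (Ne.symm hb), smul_zero]
    · simp
  choose N hN using key
  refine ⟨∑ i, N i, fun i => ?_⟩
  exact Ideal.pow_mem_of_pow_mem _ (hN i) (Finset.single_le_sum (fun _ _ => Nat.zero_le _) (Finset.mem_univ i))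

theorem SST_cut {n : ℕ} {k : Type*} [Field k] [Infinite k] (Δ : ℕ)
    (I : Ideal (MvPolynomial (Fin n) k))
    (hdim : ringKrullDim (MvPolynomial (Fin n) k ⧸ I) ≤ ((Δ + 1 : ℕ) : WithBot ℕ∞)) :
    ∃ l : MvPolynomial (Fin n) k, l.IsHomogeneous 1 ∧
      ringKrullDim (MvPolynomial (Fin n) k ⧸ (I ⊔ Ideal.span {l})) ≤ (Δ : WithBot ℕ∞) := by
  classical
  set m0 : Ideal (MvPolynomial (Fin n) k) := Ideal.span (Set.range X) with hm0
  set L := homogeneousSubmodule (Fin n) k 1 with hL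
  have hfin : I.minimalPrimes.Finite := Ideal.finite_minimalPrimes_of_isNoetherianRing _ I
  -- minimal primes not containing all linear forms
  set B : Set (Ideal (MvPolynomial (Fin n) k)) := {p ∈ I.minimalPrimes | ¬ m0 ≤ p} with hB
  have hBfin : B.Finite := hfin.subset (fun p hp => hp.1)
  obtain ⟨l, hlL, hl⟩ : ∃ l ∈ L, ∀ p ∈ B, l ∉ p := by
    have hne := Subspace.biUnion_ne_univ_of_top_notMem (k := k) (E := L)
      (s := hBfin.toFinset.image fun p => (Submodule.restrictScalars k p).comap L.subtype) (by
        rw [Finset.mem_image]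
        rintro ⟨p, hp, hpt⟩
        rw [Set.Finite.mem_toFinset] at hp
        apply hp.2
        rw [hm0, Ideal.span_le]
        rintro _ ⟨i, rfl⟩
        have : (⟨X i, isHomogeneous_X k i⟩ : L) ∈ (Submodule.restrictScalars k p).comap L.subtype := by
          rw [hpt]; trivial
        simpa using this)
    rw [Set.ne_univ_iff_exists_notMem] at hne
    obtain ⟨x, hx⟩ := hne
    refine ⟨x.1, x.2, fun p hp hxp => hx ?_⟩
    simp only [Set.mem_iUnion]
    refine ⟨(Submodule.restrictScalars k p).comap L.subtype, ?_, by simpa using hxp⟩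
    rw [Finset.mem_image]
    exact ⟨p, hBfin.mem_toFinset.2 hp, rfl⟩
  refine ⟨l, hlL, ?_⟩
  rw [ringKrullDim_quotient] at hdim ⊢
  rw [Order.krullDim]
  refine iSup_le fun c => ?_
  have hc0 : I ⊔ Ideal.span {l} ≤ c.head.1.asIdeal := c.head.2
  have hcI : I ≤ c.head.1.asIdeal := le_sup_left.trans hc0
  have hcl : l ∈ c.head.1.asIdeal := hc0 (Ideal.mem_sup_right (Ideal.mem_span_singleton_self l))
  obtain ⟨p, hp, hpc⟩ := Ideal.exists_minimalPrimes_le hcI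
  by_cases hpB : p ∈ B
  · let p' : PrimeSpectrum.zeroLocus (R := MvPolynomial (Fin n) k) I := ⟨⟨p, hp.1.1⟩, hp.1.2⟩
    let inc : PrimeSpectrum.zeroLocus (R := MvPolynomial (Fin n) k) ((I ⊔ Ideal.span {l} : Ideal _) : Set (MvPolynomial (Fin n) k)) → PrimeSpectrum.zeroLocus (R := MvPolynomial (Fin n) k) (I : Set (MvPolynomial (Fin n) k)) :=
      fun x => ⟨x.1, le_sup_left.trans (show I ⊔ Ideal.span {l} ≤ x.1.asIdeal from x.2)⟩
    let c' := c.map inc (fun _ _ h => h)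
    have hlt : p' < c'.head := by
      refine lt_of_le_of_ne hpc ?_
      intro h
      apply hl p hpB
      have h2 : p = c.head.1.asIdeal := congrArg (fun x => x.1.asIdeal) h
      rw [h2]; exact hcl
    have := (Order.LTSeries.length_le_krullDim (c'.cons p' hlt)).trans hdim
    simp only [RelSeries.cons_length] at this
    have h3 : c'.length + 1 ≤ Δ + 1 := by exact_mod_cast this
    have h4 : c'.length = c.length := rfl
    have : c.length ≤ Δ := by omega
    exact_mod_cast this
  · have hm : m0 ≤ p := by
      by_contra h
      exact hpB ⟨hp, h⟩
    have hmax : m0.IsMaximal := by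
      have : m0 = RingHom.ker (MvPolynomial.eval (0 : Fin n → k)) := by
        ext p
        have h1 := mem_pow_idealOfVars_iff' 1 p
        rw [pow_one] at h1
        rw [hm0, h1, RingHom.mem_ker]
        rw [eval_zero, constantCoeff_eq]
        constructor
        · intro h; exact h 0 (by simp)
        · intro h x hx
          have : x = 0 := by
            rw [← Finsupp.degree_eq_zero_iff]; omega
          rw [this, h]
      rw [this]
      exact RingHom.ker_isMaximal_of_surjective _ (fun a => ⟨C a, by simp⟩)
    have hlen : c.length = 0 := by
      by_contra h
      have h1 : c.head < c.last := by
        exact c.strictMono (Fin.lt_def.2 (by simpa using Nat.pos_of_ne_zero h))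
      have h2 : m0 ≤ c.head.1.asIdeal := hm.trans hpc
      have h3 : m0 = c.head.1.asIdeal := hmax.eq_of_le c.head.1.2.ne_top h2
      have h4 : c.head.1.asIdeal < c.last.1.asIdeal := h1
      exact c.last.1.2.ne_top (hmax.1.2 _ (h3 ▸ h4))
    rw [hlen]
    simp

theorem SST_partA {n : ℕ} {k : Type*} [Field k] [Infinite k] (Δ : ℕ) :
    ∀ (I : Ideal (MvPolynomial (Fin n) k)), SSTHom I →
    ringKrullDim (MvPolynomial (Fin n) k ⧸ I) ≤ (Δ : WithBot ℕ∞) →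
    ∃ l : Fin Δ → MvPolynomial (Fin n) k, (∀ i, (l i).IsHomogeneous 1) ∧
      ∃ N : ℕ, ∀ i, (X i : MvPolynomial (Fin n) k) ^ N ∈ I ⊔ Ideal.span (Set.range l) := by
  induction Δ with
  | zero =>
    intro I hI hdim
    obtain ⟨N, hN⟩ := SST_dimZero I hI (by simpa using hdim)
    exact ⟨fun i => 0, fun i => i.elim0, N, fun i => Ideal.mem_sup_left (hN i)⟩
  | succ Δ ih =>
    intro I hI hdim
    obtain ⟨l, hl, hd⟩ := SST_cut Δ I hdim
    obtain ⟨l', hl', N, hN⟩ := ih (I ⊔ Ideal.span {l})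
      (SSTHom_sup hI (SSTHom_span _ (by rintro g rfl; exact ⟨1, hl⟩))) hd
    refine ⟨Fin.cons l l', ?_, N, fun i => ?_⟩
    · intro i
      refine Fin.cases ?_ (fun j => ?_) i
      · simpa using hl
      · simpa using hl' j
    · have := hN i
      rwa [sup_assoc, ← Ideal.span_union, Set.singleton_union, ← Fin.range_cons] at this

/-! ### Part B: uniformity -/

/-- index set of Macaulay columns -/
abbrev SSTCol {ι : Type} (κ : Type) (e : ι → ℕ) (T : ℕ) : Type :=
  {c : ι × (κ →₀ ℕ) // c.2.degree + e c.1 = T}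

/-- monomials of degree `T` -/
abbrev SSTMon (κ : Type) (T : ℕ) : Type := {m : κ →₀ ℕ // m.degree = T}

instance SSTMon_finite (κ : Type) [Finite κ] (T : ℕ) : Finite (SSTMon κ T) :=
  (Finsupp.finite_of_degree_le (σ := κ) T).subset (fun _ h => le_of_eq h)

instance SSTCol_finite {ι : Type} [Finite ι] (κ : Type) [Finite κ] (e : ι → ℕ) (T : ℕ) :
    Finite (SSTCol κ e T) := by
  refine Set.Finite.subset (s := (Set.univ : Set ι) ×ˢ {m : κ →₀ ℕ | m.degree ≤ T})
    (Set.finite_univ.prod (Finsupp.finite_of_degree_le T)) ?_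
  rintro ⟨s, m⟩ h
  have h' : m.degree + e s = T := h
  simp only [Set.mem_prod, Set.mem_univ, Set.mem_ofPred_eq, true_and]
  omega

/-- All monomials of degree `T` lie in the span of the degree `T` multiples of the `g s`. -/
def SSTGood {ι κ k : Type} [Field k] (e : ι → ℕ) (g : ι → MvPolynomial κ k) (T : ℕ) : Prop :=
  ∀ m : κ →₀ ℕ, m.degree = T → monomial m (1 : k) ∈
    Submodule.span k (Set.range fun c : SSTCol κ e T => g c.1.1 * monomial c.1.2 (1 : k))

theorem SSTGood_add {ι κ k : Type} [Field k] {e : ι → ℕ} {g : ι → MvPolynomial κ k} {T : ℕ}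
    (h : SSTGood e g T) (u : κ →₀ ℕ) : ∀ m : κ →₀ ℕ, m.degree = T →
    monomial (m + u) (1 : k) ∈
    Submodule.span k (Set.range fun c : SSTCol κ e (T + u.degree) =>
      g c.1.1 * monomial c.1.2 (1 : k)) := by
  intro m hm
  have h1 := h m hm
  have h2 := Submodule.mem_map_of_mem (f := LinearMap.mulRight k (monomial u (1 : k))) h1
  rw [Submodule.map_span] at h2
  have h3 : (LinearMap.mulRight k (monomial u (1 : k))) (monomial m (1 : k))
      = monomial (m + u) (1 : k) := by simp [monomial_mul]
  rw [h3] at h2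
  refine Submodule.span_mono ?_ h2
  rintro _ ⟨_, ⟨c, rfl⟩, rfl⟩
  refine ⟨⟨(c.1.1, c.1.2 + u), ?_⟩, ?_⟩
  · have := c.2
    simp only [map_add]
    omega
  · simp [mul_assoc, monomial_mul]

theorem SST_exists_le_degree {κ : Type} (m : κ →₀ ℕ) (a b : ℕ) (h : m.degree = a + b) :
    ∃ m1 m2 : κ →₀ ℕ, m1.degree = a ∧ m2.degree = b ∧ m = m1 + m2 := by
  classical
  induction b generalizing m with
  | zero => exact ⟨m, 0, by simpa using h, by simp, by simp⟩
  | succ b ih =>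
    have : m ≠ 0 := by
      rintro rfl
      simp at h
    obtain ⟨i, hi⟩ := Finsupp.ne_iff.1 this
    have hle : Finsupp.single i 1 ≤ m := by
      rw [Finsupp.single_le_iff]
      exact Nat.one_le_iff_ne_zero.2 hi
    obtain ⟨m', rfl⟩ := exists_add_of_le hle
    rw [map_add, Finsupp.degree_single] at h
    obtain ⟨m1, m2, h1, h2, h3⟩ := ih m' (by omega)
    refine ⟨m1, m2 + Finsupp.single i 1, h1, ?_, ?_⟩
    · rw [map_add, Finsupp.degree_single, h2]
    · rw [h3]; abel

theorem SSTGood_mono {ι κ k : Type} [Field k] {e : ι → ℕ} {g : ι → MvPolynomial κ k} {T T' : ℕ}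
    (h : SSTGood e g T) (hT : T ≤ T') : SSTGood e g T' := by
  intro m hm
  obtain ⟨b, rfl⟩ := Nat.exists_eq_add_of_le hT
  obtain ⟨m1, m2, h1, h2, rfl⟩ := SST_exists_le_degree m T b hm
  have := SSTGood_add h m2 m1 h1
  rwa [h2] at this

theorem SST_deg_of_hom {κ k : Type} [Field k] {g : MvPolynomial κ k} {e : ℕ}
    (hg : g.IsHomogeneous e) {m : κ →₀ ℕ} (h : coeff m g ≠ 0) : m.degree = e := by
  have := hg h
  rw [Finsupp.degree_eq_weight_one]; exact this

theorem SST_partB' {ι κ k : Type} [Fintype ι] [Fintype κ] [Field k] (e : ι → ℕ)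
    (g : ι → MvPolynomial κ k) (hg : ∀ s, (g s).IsHomogeneous (e s)) (N : ℕ)
    (h : ∀ i, (X i : MvPolynomial κ k) ^ N ∈ Ideal.span (Set.range g)) :
    ∃ T, SSTGood e g T := by
  classical
  refine ⟨Fintype.card κ * N + 1, fun m hm => ?_⟩
  set T := Fintype.card κ * N + 1 with hT
  have hmem : monomial m (1 : k) ∈ Ideal.span (Set.range g) := by
    obtain ⟨i, hi⟩ : ∃ i, N ≤ m i := by
      by_contra hcon
      push Not at hcon
      have : m.degree ≤ Fintype.card κ * N := by
        rw [Finsupp.degree_eq_sum]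
        calc ∑ i, m i ≤ ∑ i : κ, N := Finset.sum_le_sum fun i _ => (hcon i).le
          _ = _ := by simp
      omega
    have hle : Finsupp.single i N ≤ m := by
      rwa [Finsupp.single_le_iff]
    obtain ⟨m', rfl⟩ := exists_add_of_le hle
    have : monomial (Finsupp.single i N + m') (1 : k) = X i ^ N * monomial m' 1 := by
      rw [X_pow_eq_monomial, monomial_mul, one_mul]
    rw [this]
    exact Ideal.mul_mem_right _ _ (h i)
  rw [Ideal.mem_span_range_iff_exists_fun] at hmem
  obtain ⟨c, hc⟩ := hmem
  have h1 : homogeneousComponent T (monomial m (1 : k)) = monomial m 1 := by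
    rw [homogeneousComponent_of_mem (isHomogeneous_monomial 1 hm), if_pos rfl]
  rw [← h1, ← hc, map_sum]
  refine sum_mem fun s _ => ?_
  rw [mul_comm]
  rcases lt_or_ge T (e s) with hlt | hge
  · rw [SST_homComp_mul_lt (hg s) _ _ hlt]; exact zero_mem _
  · obtain ⟨b, hb⟩ := Nat.exists_eq_add_of_le' hge
    rw [hb, SST_homComp_mul (hg s)]
    have hq := homogeneousComponent_isHomogeneous b (c s)
    set q := homogeneousComponent b (c s)
    rw [q.as_sum, Finset.mul_sum]
    refine sum_mem fun ν hν => ?_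
    have hν' : ν.degree = b := SST_deg_of_hom hq (mem_support_iff.1 hν)
    have : g s * monomial ν (coeff ν q) = coeff ν q • (g s * monomial ν 1) := by
      rw [← mul_smul_comm (coeff ν q) (g s) (monomial ν (1 : k)), smul_monomial, smul_eq_mul, mul_one]
    rw [this]
    refine Submodule.smul_mem _ _ (Submodule.subset_span ⟨⟨(s, ν), ?_⟩, rfl⟩)
    simp [hν']

/-- generic Macaulay matrix -/
def SSTW {ι κ : Type} (k : Type) [Field k] (e : ι → ℕ) (T : ℕ) (m : SSTMon κ T)
    (c : SSTCol κ e T) : MvPolynomial ((s : ι) × SSTMon κ (e s)) k := by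
  classical
  exact if h : c.1.2 ≤ m.1 ∧ (m.1 - c.1.2).degree = e c.1.1 then X ⟨c.1.1, ⟨m.1 - c.1.2, h.2⟩⟩ else 0

def SSTpt {ι κ k : Type} [Field k] (e : ι → ℕ) (g : ι → MvPolynomial κ k) :
    ((s : ι) × SSTMon κ (e s)) → k := fun x => coeff x.2.1 (g x.1)

theorem SSTW_eval {ι κ k : Type} [Field k] (e : ι → ℕ) (g : ι → MvPolynomial κ k) (T : ℕ)
    (m : SSTMon κ T) (c : SSTCol κ e T) :
    eval (SSTpt e g) (SSTW k e T m c) = coeff m.1 (g c.1.1 * monomial c.1.2 (1 : k)) := by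
  classical
  rw [coeff_mul_monomial', SSTW]
  by_cases h : c.1.2 ≤ m.1
  · have h2 : (m.1 - c.1.2).degree = e c.1.1 := by
      have h3 : m.1 = (m.1 - c.1.2) + c.1.2 := (tsub_add_cancel_of_le h).symm
      have h4 := congrArg Finsupp.degree h3
      rw [map_add, m.2] at h4
      have := c.2
      omega
    rw [dif_pos ⟨h, h2⟩, if_pos h]
    simp [SSTpt]
  · rw [dif_neg (fun h' => h h'.1), if_neg h]
    simp

theorem SST_open {ι κ k : Type} [Fintype ι] [Fintype κ] [Field k] (e : ι → ℕ) (T : ℕ)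
    (g : ι → MvPolynomial κ k) (h : SSTGood e g T) :
    ∃ D : MvPolynomial ((s : ι) × SSTMon κ (e s)) k, eval (SSTpt e g) D ≠ 0 ∧
      ∀ g' : ι → MvPolynomial κ k, (∀ s, (g' s).IsHomogeneous (e s)) →
        eval (SSTpt e g') D ≠ 0 → SSTGood e g' T := by
  classical
  have := Fintype.ofFinite (SSTMon κ T)
  have := Fintype.ofFinite (SSTCol κ e T)
  have h' : ∀ m : SSTMon κ T, ∃ y : SSTCol κ e T → k,
      ∑ c, y c • (g c.1.1 * monomial c.1.2 (1 : k)) = monomial m.1 1 := fun m =>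
    (Submodule.mem_span_range_iff_exists_fun k).1 (h m.1 m.2)
  choose y hy using h'
  let A : Matrix (SSTMon κ T) (SSTMon κ T) (MvPolynomial ((s : ι) × SSTMon κ (e s)) k) :=
    Matrix.of fun m m' => ∑ c, SSTW k e T m c * C (y m' c)
  let Y : Matrix (SSTCol κ e T) (SSTMon κ T) k := Matrix.of fun c m => y m c
  let Wg : (ι → MvPolynomial κ k) → Matrix (SSTMon κ T) (SSTCol κ e T) k := fun g =>
    Matrix.of fun m c => coeff m.1 (g c.1.1 * monomial c.1.2 (1 : k))
  have hev : ∀ g : ι → MvPolynomial κ k, eval (SSTpt e g) A.det = (Wg g * Y).det := by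
    intro g
    rw [RingHom.map_det]
    congr 1
    ext m m'
    rw [Matrix.mul_apply]
    simp [A, Wg, Y, SSTW_eval]
  refine ⟨A.det, ?_, ?_⟩
  · rw [hev]
    have : Wg g * Y = 1 := by
      ext m m'
      rw [Matrix.mul_apply, Matrix.one_apply]
      have := congrArg (coeff m.1) (hy m')
      rw [coeff_sum, coeff_monomial] at this
      simp only [coeff_smul, smul_eq_mul] at this
      have h2 : (m'.1 = m.1) ↔ (m = m') := by rw [Subtype.ext_iff, eq_comm]
      simp only [h2] at this
      rw [← this]
      refine Finset.sum_congr rfl fun c _ => ?_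
      exact mul_comm _ _
    rw [this]
    simp
  · intro g' hg' hD m hm
    rw [hev] at hD
    have hu : IsUnit (Wg g' * Y).det := isUnit_iff_ne_zero.2 hD
    have hinv : Wg g' * (Y * (Wg g' * Y)⁻¹) = 1 := by
      rw [← Matrix.mul_assoc]
      exact Matrix.mul_nonsing_inv _ hu
    set Z := Y * (Wg g' * Y)⁻¹
    rw [Submodule.mem_span_range_iff_exists_fun]
    refine ⟨fun c => Z c ⟨m, hm⟩, ?_⟩
    ext m'
    rw [coeff_sum, coeff_monomial]
    simp only [coeff_smul, smul_eq_mul]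
    by_cases hm' : m'.degree = T
    · have h3 := congrFun (congrFun hinv ⟨m', hm'⟩) ⟨m, hm⟩
      rw [Matrix.mul_apply, Matrix.one_apply] at h3
      have h2 : (m = m') ↔ ((⟨m', hm'⟩ : SSTMon κ T) = ⟨m, hm⟩) := by
        rw [Subtype.ext_iff, eq_comm]
      simp only [h2]
      rw [← h3]
      refine Finset.sum_congr rfl fun c _ => ?_
      exact mul_comm _ _
    · rw [if_neg (by rintro rfl; exact hm' hm)]
      refine Finset.sum_eq_zero fun c _ => ?_
      have hh : (g' c.1.1 * monomial c.1.2 (1 : k)).IsHomogeneous T := by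
        have := (hg' c.1.1).mul (isHomogeneous_monomial (R := k) 1 (d := c.1.2) rfl)
        rwa [add_comm, c.2] at this
      have : coeff m' (g' c.1.1 * monomial c.1.2 (1 : k)) = 0 := by
        by_contra hne
        exact hm' (SST_deg_of_hom hh hne)
      rw [this, mul_zero]

theorem SST_partB (ι κ k : Type) [Fintype ι] [Fintype κ] [Field k] (e : ι → ℕ) :
    ∃ T0, ∀ g : ι → MvPolynomial κ k, (∀ s, (g s).IsHomogeneous (e s)) →
      ∀ T, SSTGood e g T → SSTGood e g T0 := by
  classical
  let J0 : ℕ → Set (MvPolynomial ((s : ι) × SSTMon κ (e s)) k) := fun T =>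
    {D | ∀ g' : ι → MvPolynomial κ k, (∀ s, (g' s).IsHomogeneous (e s)) →
        eval (SSTpt e g') D ≠ 0 → SSTGood e g' T}
  let J : ℕ →o Ideal (MvPolynomial ((s : ι) × SSTMon κ (e s)) k) :=
    ⟨fun T => Ideal.span (J0 T), fun T T' hT => Ideal.span_mono
      fun D hD g' hg' hne => SSTGood_mono (hD g' hg' hne) hT⟩
  have hN : IsNoetherianRing (MvPolynomial ((s : ι) × SSTMon κ (e s)) k) := inferInstance
  obtain ⟨T0, hT0⟩ := monotone_stabilizes_iff_noetherian.2 hN J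
  refine ⟨T0, fun g hg T hT => ?_⟩
  obtain ⟨D, hD, hD'⟩ := SST_open e T g hT
  have h1 : D ∈ J T0 := by
    rw [hT0 (max T T0) (le_max_right _ _)]
    exact J.monotone (le_max_left _ _) (Ideal.subset_span hD')
  by_contra hbad
  apply hD
  have h2 : J T0 ≤ RingHom.ker (eval (SSTpt e g)) := by
    refine Ideal.span_le.2 fun D' hD' => ?_
    by_contra hne
    exact hbad (hD' g hg hne)
  exact h2 h1

/-! ### Part C: point counting -/

theorem SST_partC {ι1 ι2 κ k : Type} [Fintype ι1] [Fintype ι2] [Fintype κ] [Field k]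
    (e1 : ι1 → ℕ) (g : ι1 ⊕ ι2 → MvPolynomial κ k) (T0 : ℕ)
    (hgood : SSTGood (Sum.elim e1 (fun _ => 1)) g T0) (S : Finset k) (Xs : Finset (κ → k))
    (hX : ∀ x ∈ Xs, (∀ i, x i ∈ S) ∧ ∀ s : ι1, eval x (g (Sum.inl s)) = 0) :
    Xs.card ≤ (Fintype.card κ * S.card + 1) ^ (Fintype.card ι2) *
      Nat.card {m : κ →₀ ℕ // m.degree < T0} := by
  classical
  have hfinM : Finite {m : κ →₀ ℕ // m.degree < T0} := Finsupp.finite_of_degree_lt T0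
  have := Fintype.ofFinite {m : κ →₀ ℕ // m.degree < T0}
  set t := Fintype.card κ * S.card with ht
  let E : MvPolynomial κ k →ₗ[k] (Xs → k) :=
    LinearMap.pi fun x => (MvPolynomial.aeval (R := k) x.1).toLinearMap
  have hE : ∀ p x, E p x = eval x.1 p := fun p x => by
    simp [E, MvPolynomial.aeval_eq_eval]
  have hEmul : ∀ p q, E (p * q) = E p * E q := fun p q => by
    ext x; simp [hE]
  let w : (ι2 → ℕ) → (κ →₀ ℕ) → (Xs → k) := fun α μ =>
    E (∏ i, g (Sum.inr i) ^ α i) * E (monomial μ 1)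
  let U : ℕ → Submodule k (Xs → k) := fun r => Submodule.span k
    {f | ∃ (α : ι2 → ℕ) (μ : κ →₀ ℕ), ∑ i, α i ≤ r ∧ μ.degree < T0 ∧ f = w α μ}
  have hUmono : ∀ r r', r ≤ r' → U r ≤ U r' := by
    intro r r' h
    refine Submodule.span_mono ?_
    rintro _ ⟨α, μ, h1, h2, rfl⟩
    exact ⟨α, μ, h1.trans h, h2, rfl⟩
  have hUmul : ∀ r i f, f ∈ U r → E (g (Sum.inr i)) * f ∈ U (r + 1) := by
    intro r i f hf
    have h2 := Submodule.mem_map_of_mem (f := LinearMap.mulLeft k (E (g (Sum.inr i)))) hf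
    rw [Submodule.map_span] at h2
    refine Submodule.span_mono ?_ h2
    rintro _ ⟨_, ⟨α, μ, h1, h2, rfl⟩, rfl⟩
    refine ⟨α + Pi.single i 1, μ, ?_, h2, ?_⟩
    · simp only [Pi.add_apply, Finset.sum_add_distrib]
      rw [Finset.sum_pi_single']
      simp
      omega
    · simp only [w, LinearMap.mulLeft_apply, Pi.add_apply, pow_add, Finset.prod_mul_distrib]
      have : ∏ j, g (Sum.inr j) ^ (Pi.single i 1 : ι2 → ℕ) j = g (Sum.inr i) := by
        rw [Finset.prod_eq_single i]
        · simp
        · intro b _ hb; simp [hb]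
        · simp
      rw [this, hEmul]
      ring
  have hmon : ∀ r (m : κ →₀ ℕ), m.degree = r → E (monomial m 1) ∈ U r := by
    intro r
    induction r using Nat.strong_induction_on with
    | _ r ih =>
      intro m hm
      rcases lt_or_ge r T0 with hlt | hge
      · refine Submodule.subset_span ⟨0, m, by simp, by omega, ?_⟩
        ext x
        simp [w, hE]
      · have h1 := SSTGood_mono hgood hge m hm
        have h2 := Submodule.mem_map_of_mem (f := E) h1
        rw [Submodule.map_span] at h2
        refine (Submodule.span_le.2 ?_) h2
        rintro _ ⟨_, ⟨⟨⟨s, ν⟩, hc⟩, rfl⟩, rfl⟩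
        simp only [hEmul]
        rcases s with s | i
        · have : E (g (Sum.inl s)) = 0 := by
            ext x
            rw [hE, (hX x.1 x.2).2 s]; rfl
          rw [this, zero_mul]
          exact zero_mem _
        · simp only [Sum.elim_inr] at hc
          subst hc
          exact hUmul _ _ _ (ih ν.degree (by omega) ν rfl)
  have hpoly : ∀ p : MvPolynomial κ k, p.totalDegree ≤ t → E p ∈ U t := by
    intro p hp
    rw [p.as_sum, map_sum]
    refine sum_mem fun m hm => ?_
    have h1 : monomial m (coeff m p) = coeff m p • monomial m (1 : k) := by
      rw [smul_monomial, smul_eq_mul, mul_one]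
    rw [h1, LinearMap.map_smul]
    refine Submodule.smul_mem _ _ (hUmono m.degree t ?_ (hmon _ m rfl))
    have := le_totalDegree hm
    exact this.trans hp
  let v : (ι2 → Fin (t + 1)) × {m : κ →₀ ℕ // m.degree < T0} → (Xs → k) := fun a =>
    w (fun i => a.1 i) a.2.1
  have hUv : U t ≤ Submodule.span k (Set.range v) := by
    refine Submodule.span_mono ?_
    rintro _ ⟨α, μ, h1, h2, rfl⟩
    refine ⟨(fun i => ⟨α i, ?_⟩, ⟨μ, h2⟩), rfl⟩
    have := Finset.single_le_sum (f := α) (fun _ _ => Nat.zero_le _) (Finset.mem_univ i)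
    omega
  have hsingle : ∀ x0 : Xs, (Pi.single x0 1 : Xs → k) ∈ U t := by
    intro x0
    let p : MvPolynomial κ k := ∏ i, ∏ s ∈ S.erase (x0.1 i), (X i - C s)
    have hp : p.totalDegree ≤ t := by
      refine (totalDegree_finsetProd _ _).trans ?_
      have : ∀ i ∈ (Finset.univ : Finset κ),
          (∏ s ∈ S.erase (x0.1 i), (X i - C s : MvPolynomial κ k)).totalDegree ≤ S.card := by
        intro i _
        refine (totalDegree_finsetProd _ _).trans ?_
        refine (Finset.sum_le_card_nsmul _ _ 1 ?_).trans ?_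
        · intro s _
          refine (totalDegree_sub _ _).trans ?_
          simp
        · rw [smul_eq_mul, mul_one]
          exact Finset.card_le_card (Finset.erase_subset _ _)
      refine (Finset.sum_le_card_nsmul _ _ _ this).trans ?_
      simp [ht]
    have h1 := hpoly p hp
    have hne : eval x0.1 p ≠ 0 := by
      simp only [p, map_prod, map_sub, eval_X, eval_C]
      refine Finset.prod_ne_zero_iff.2 fun i _ => Finset.prod_ne_zero_iff.2 fun s hs => ?_
      exact sub_ne_zero.2 (Finset.ne_of_mem_erase hs).symm
    have h2 : (Pi.single x0 1 : Xs → k) = (eval x0.1 p)⁻¹ • E p := by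
      ext x
      rw [Pi.smul_apply, hE, smul_eq_mul]
      by_cases hx : x = x0
      · subst hx
        simp [hne]
      · rw [Pi.single_eq_of_ne hx]
        have : eval x.1 p = 0 := by
          obtain ⟨i, hi⟩ : ∃ i, x.1 i ≠ x0.1 i := by
            by_contra hcon
            push Not at hcon
            exact hx (Subtype.ext (funext hcon))
          simp only [p, map_prod, map_sub, eval_X, eval_C]
          refine Finset.prod_eq_zero (Finset.mem_univ i) ?_
          refine Finset.prod_eq_zero (i := x.1 i) ?_ (sub_self _)
          exact Finset.mem_erase.2 ⟨hi, (hX x.1 x.2).1 i⟩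
        rw [this, mul_zero]
    rw [h2]
    exact Submodule.smul_mem _ _ h1
  have htop : Submodule.span k (Set.range v) = ⊤ := by
    rw [eq_top_iff]
    intro f _
    have : f = ∑ x : Xs, f x • (Pi.single x 1 : Xs → k) := by
      ext y
      simp [Finset.sum_apply, Pi.single_apply]
    rw [this]
    exact sum_mem fun x _ => Submodule.smul_mem _ _ (hUv (hsingle x))
  have hfr := finrank_range_le_card (R := k) v
  rw [Set.finrank, htop, finrank_top, Module.finrank_fintype_fun_eq_card] at hfr
  simpa [Nat.card_eq_fintype_card] using hfr

/-! ### The multilinear form attached to a polynomial -/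

/-- iterated directional derivatives, evaluated at `0` -/
def SSTM {n : ℕ} {A : Type} [CommRing A] : (r : ℕ) → MvPolynomial (Fin n) A → (Fin r → Fin n → A) → A
  | 0, p, _ => coeff 0 p
  | r + 1, p, h => ∑ l, h 0 l * SSTM r (pderiv l p) (fun i => h i.succ)

theorem SSTM_add {n : ℕ} {A : Type} [CommRing A] (r : ℕ) : ∀ (p p' : MvPolynomial (Fin n) A)
    (h : Fin r → Fin n → A), SSTM r (p + p') h = SSTM r p h + SSTM r p' h := by
  induction r with
  | zero => intro p p' h; simp [SSTM]
  | succ r ih => intro p p' h; simp [SSTM, ih, mul_add, Finset.sum_add_distrib]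

theorem SSTM_smul {n : ℕ} {A : Type} [CommRing A] (r : ℕ) : ∀ (c : A) (p : MvPolynomial (Fin n) A)
    (h : Fin r → Fin n → A), SSTM r (c • p) h = c * SSTM r p h := by
  induction r with
  | zero => intro c p h; simp [SSTM]
  | succ r ih =>
    intro c p h
    simp only [SSTM, Finset.mul_sum, Derivation.map_smul, ih]
    exact Finset.sum_congr rfl fun _ _ => by ring

theorem SSTM_C_mul {n : ℕ} {A : Type} [CommRing A] (r : ℕ) (c : A) (p : MvPolynomial (Fin n) A)
    (h : Fin r → Fin n → A) : SSTM r (C c * p) h = c * SSTM r p h := by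
  rw [← SSTM_smul, smul_eq_C_mul]

theorem SSTM_zero {n : ℕ} {A : Type} [CommRing A] (r : ℕ)
    (h : Fin r → Fin n → A) : SSTM r (0 : MvPolynomial (Fin n) A) h = 0 := by
  have := SSTM_smul r (0 : A) (0 : MvPolynomial (Fin n) A) h
  simpa using this

theorem SSTM_sum {n : ℕ} {A : Type} [CommRing A] {ι : Type} (s : Finset ι) (r : ℕ)
    (p : ι → MvPolynomial (Fin n) A)
    (h : Fin r → Fin n → A) : SSTM r (∑ i ∈ s, p i) h = ∑ i ∈ s, SSTM r (p i) h := by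
  classical
  induction s using Finset.induction_on with
  | empty => simp [SSTM_zero]
  | insert a s ha ih => rw [Finset.sum_insert ha, Finset.sum_insert ha, SSTM_add, ih]

theorem SSTM_map {n : ℕ} {A B : Type} [CommRing A] [CommRing B] (φ : A →+* B) (r : ℕ) :
    ∀ (p : MvPolynomial (Fin n) A)
    (h : Fin r → Fin n → A), SSTM r (map φ p) (fun i j => φ (h i j)) = φ (SSTM r p h) := by
  induction r with
  | zero => intro p h; simp [SSTM, coeff_map]
  | succ r ih =>
    intro p h
    simp only [SSTM, map_sum, map_mul, pderiv_map]
    exact Finset.sum_congr rfl fun l _ => by rw [ih _ (fun i => h i.succ)]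

theorem SSTM_diag {n : ℕ} {A : Type} [CommRing A] (r : ℕ) :
    ∀ (p : MvPolynomial (Fin n) A) (_ : p.IsHomogeneous r)
    (x : Fin n → A), SSTM r p (fun _ => x) = r.factorial * eval x p := by
  induction r with
  | zero =>
    intro p hp x
    have : p.totalDegree = 0 := Nat.le_zero.1 hp.totalDegree_le
    rw [totalDegree_eq_zero_iff_eq_C] at this
    rw [this]; simp [SSTM]
  | succ r ih =>
    intro p hp x
    simp only [SSTM]
    have h1 := fun l => ih (pderiv l p) (by simpa using hp.pderiv (i := l)) x
    simp only [h1]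
    have h2 := congrArg (eval x) hp.sum_X_mul_pderiv
    simp at h2
    rw [Nat.factorial_succ]
    push_cast
    have : ∑ l, x l * (((r.factorial : ℕ) : A) * eval x (pderiv l p)) =
      r.factorial * ∑ l, x l * eval x (pderiv l p) := by
      rw [Finset.mul_sum]; exact Finset.sum_congr rfl fun _ _ => by ring
    rw [this, h2]; ring

theorem SSTM_hom {n : ℕ} {k κ : Type} [CommRing k] (r : ℕ) :
    ∀ (p : MvPolynomial (Fin n) k) (h : Fin r → Fin n → MvPolynomial κ k)
    (_ : ∀ i j, (h i j).IsHomogeneous 1), (SSTM r (map C p) h).IsHomogeneous r := by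
  induction r with
  | zero => intro p h _; simp only [SSTM, coeff_map]; exact isHomogeneous_C _ _
  | succ r ih =>
    intro p h hh
    simp only [SSTM]
    refine IsHomogeneous.sum _ _ _ fun l _ => ?_
    rw [pderiv_map]
    have h1 := (hh 0 l).mul (ih (pderiv l p) (fun i => h i.succ) fun i j => hh _ _)
    rwa [add_comm 1 r] at h1

theorem SSTM_eval {n : ℕ} {k κ : Type} [CommRing k] (r : ℕ)
    (p : MvPolynomial (Fin n) k) (h : Fin r → Fin n → MvPolynomial κ k) {B : Type} [CommRing B]
    (ψ : MvPolynomial κ k →+* B) : ψ (SSTM r (map C p) h)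
      = SSTM r (map (ψ.comp C) p) (fun i j => ψ (h i j)) := by
  rw [← SSTM_map, MvPolynomial.map_map]

/-- `p` has only terms of degree `< m` -/
def SSTL {n : ℕ} {A : Type} [CommRing A] (m : ℕ) (p : MvPolynomial (Fin n) A) : Prop :=
  ∀ s : Fin n →₀ ℕ, m ≤ s.degree → coeff s p = 0

theorem SSTL_pderiv {n : ℕ} {A : Type} [CommRing A] {m : ℕ} {p : MvPolynomial (Fin n) A}
    (h : SSTL (m + 1) p) (l : Fin n) : SSTL m (pderiv l p) := by
  intro s hs
  rw [coeff_pderiv, h, zero_mul]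
  rw [map_add, Finsupp.degree_single]; omega

theorem SSTM_L {n : ℕ} {A : Type} [CommRing A] (r : ℕ) : ∀ (p : MvPolynomial (Fin n) A)
    (_ : SSTL r p) (h : Fin r → Fin n → A), SSTM r p h = 0 := by
  induction r with
  | zero => intro p hp h; exact hp 0 (Nat.zero_le _)
  | succ r ih =>
    intro p hp h
    simp only [SSTM]
    exact Finset.sum_eq_zero fun l _ => by rw [ih _ (SSTL_pderiv hp l), mul_zero]

theorem SSTL_zero {n : ℕ} {A : Type} [CommRing A] {m : ℕ} :
    SSTL m (0 : MvPolynomial (Fin n) A) := fun _ _ => coeff_zero _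

theorem SSTL_add {n : ℕ} {A : Type} [CommRing A] {m : ℕ} {p p' : MvPolynomial (Fin n) A}
    (h : SSTL m p) (h' : SSTL m p') : SSTL m (p + p') := fun s hs => by
  rw [coeff_add, h s hs, h' s hs, add_zero]

theorem SSTL_mono {n : ℕ} {A : Type} [CommRing A] {m m' : ℕ} {p : MvPolynomial (Fin n) A}
    (h : SSTL m p) (hm : m ≤ m') : SSTL m' p := fun s hs => h s (hm.trans hs)

theorem SSTL_C_mul {n : ℕ} {A : Type} [CommRing A] {m : ℕ} {p : MvPolynomial (Fin n) A}
    (h : SSTL m p) (c : A) : SSTL m (C c * p) := fun s hs => by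
  rw [coeff_C_mul, h s hs, mul_zero]

theorem SSTL_sum {n : ℕ} {A : Type} [CommRing A] {m : ℕ} {ι : Type} (t : Finset ι)
    (p : ι → MvPolynomial (Fin n) A)
    (h : ∀ i ∈ t, SSTL m (p i)) : SSTL m (∑ i ∈ t, p i) := fun s hs => by
  rw [coeff_sum]; exact Finset.sum_eq_zero fun i hi => h i hi s hs

theorem SSTL_X_mul {n : ℕ} {A : Type} [CommRing A] {m : ℕ} {p : MvPolynomial (Fin n) A}
    (h : SSTL m p) (i : Fin n) : SSTL (m + 1) (X i * p) := fun s hs => by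
  rw [coeff_X_mul']
  split_ifs with hi
  · apply h
    have h1 : s = (s - Finsupp.single i 1) + Finsupp.single i 1 := by
      rw [tsub_add_cancel_of_le]
      rw [Finsupp.single_le_iff]
      exact Nat.one_le_iff_ne_zero.2 (Finsupp.mem_support_iff.1 hi)
    rw [h1, map_add, Finsupp.degree_single] at hs
    omega
  · rfl

theorem SSTL_map {n : ℕ} {A B : Type} [CommRing A] [CommRing B] (φ : A →+* B) {m : ℕ}
    {p : MvPolynomial (Fin n) A} (h : SSTL m p) : SSTL m (map φ p) := fun s hs => by
  rw [coeff_map, h s hs, map_zero]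

theorem SSTL_deg {n : ℕ} {A : Type} [CommRing A] 
    {p : MvPolynomial (Fin n) A} : SSTL (p.totalDegree + 1) p := fun s hs => by
  by_contra h
  have := le_totalDegree (mem_support_iff.2 h)
  rw [Finsupp.degree_apply] at hs
  simp only [Finsupp.sum] at this
  omega

theorem SSTM_bound {n : ℕ} (r : ℕ) : ∀ (p : MvPolynomial (Fin n) ℤ) (B H : ℝ) (_ : 0 ≤ B)
    (_ : 0 ≤ H)
    (_ : ∀ s : Fin n →₀ ℕ, s.degree = r → |((coeff s p : ℤ) : ℝ)| ≤ B) (h : Fin r → Fin n → ℤ)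
    (_ : ∀ i j, |((h i j : ℤ) : ℝ)| ≤ H),
    |((SSTM r p h : ℤ) : ℝ)| ≤ B * (r.factorial * (n : ℝ) ^ r * H ^ r) := by
  induction r with
  | zero => intro p B H hB hH hp h hh; simpa [SSTM] using hp 0 (by simp)
  | succ r ih =>
    intro p B H hB hH hp h hh
    have key : ∀ l : Fin n, |((h 0 l * SSTM r (pderiv l p) (fun i => h i.succ) : ℤ) : ℝ)| ≤
        H * ((B * (r + 1)) * (r.factorial * (n : ℝ) ^ r * H ^ r)) := by
      intro l
      push_cast
      rw [abs_mul]
      refine mul_le_mul (hh 0 l) (ih _ _ H (by positivity) hH ?_ _ fun i j => hh _ _)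
        (abs_nonneg _) hH
      intro s hs
      rw [coeff_pderiv]
      push_cast
      rw [abs_mul]
      refine mul_le_mul (hp _ (by rw [map_add, hs, Finsupp.degree_single])) ?_ (abs_nonneg _) hB
      have : s l ≤ r := hs ▸ Finsupp.le_degree l s
      rw [abs_of_nonneg (by positivity)]
      have : (s l : ℝ) ≤ r := by exact_mod_cast this
      linarith
    simp only [SSTM]
    push_cast
    refine (Finset.abs_sum_le_sum_abs _ _).trans ?_
    refine (Finset.sum_le_card_nsmul _ _ (H * ((B * (r + 1)) * (r.factorial * (n : ℝ) ^ r * H ^ r)))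
      fun l _ => by have := key l; push_cast at this; exact this).trans ?_
    simp only [Finset.card_univ, Fintype.card_fin, nsmul_eq_mul]
    rw [Nat.factorial_succ]
    push_cast
    apply le_of_eq
    ring

/-! ### Counting zeros of the multilinear forms -/

theorem SST_nilp {n e Δ : ℕ} {k : Type} [Field k] [CharZero k]
    (F : MvPolynomial (Fin n) k) (hF : F.IsHomogeneous (e + 2))
    (l : Fin Δ → MvPolynomial (Fin n) k) (N : ℕ)
    (hN : ∀ i, X i ^ N ∈ Ideal.span (Set.range fun j : Fin n => pderiv j F)
      ⊔ Ideal.span (Set.range l))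
    (J : Ideal (MvPolynomial (Fin (e + 1) × Fin n) k))
    (h1 : ∀ j : Fin n, SSTM (e + 1) (map C (pderiv j F))
      (fun i j => (X (i, j) : MvPolynomial (Fin (e + 1) × Fin n) k)) ∈ J)
    (h2 : ∀ (i : Fin e) (j : Fin n), (X (i.succ, j) - X (0, j) :
      MvPolynomial (Fin (e + 1) × Fin n) k) ∈ J)
    (h3 : ∀ s : Fin Δ, rename (fun j : Fin n => ((0 : Fin (e + 1)), j)) (l s) ∈ J) :
    ∀ ij, (X ij : MvPolynomial (Fin (e + 1) × Fin n) k) ^ N ∈ J := by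
  have hx : ∀ i j, Ideal.Quotient.mk J (X (i, j)) = Ideal.Quotient.mk J (X (0, j)) := by
    intro i j
    refine Fin.cases rfl (fun i => ?_) i
    exact Ideal.Quotient.eq.2 (h2 i j)
  let ρ := (rename (R := k) (fun j : Fin n => ((0 : Fin (e + 1)), j))).toRingHom
  have hρ : ∀ p, eval (fun j => Ideal.Quotient.mk J (X (0, j)))
      (map ((Ideal.Quotient.mk J).comp C) p) = Ideal.Quotient.mk J (ρ p) := by
    intro p
    rw [eval_map]
    induction p using MvPolynomial.induction_on with
    | C a => simp [ρ]
    | add p q hp hq => rw [eval₂_add, hp, hq, map_add, map_add]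
    | mul_X p i hp => rw [eval₂_mul, hp, map_mul, map_mul, eval₂_X]; simp [ρ]
  have hle : Ideal.span (Set.range fun j : Fin n => pderiv j F)
      ⊔ Ideal.span (Set.range l) ≤ J.comap ρ := by
    rw [sup_le_iff, Ideal.span_le, Ideal.span_le]
    constructor
    · rintro _ ⟨j, rfl⟩
      have ha := Ideal.Quotient.eq_zero_iff_mem.2 (h1 j)
      rw [SSTM_eval] at ha
      simp only [hx] at ha
      have hom : (pderiv j F).IsHomogeneous (e + 1) := by simpa using hF.pderiv (i := j)
      rw [SSTM_diag _ _ (hom.map _), hρ] at ha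
      have hc : Ideal.Quotient.mk J (C ((((e + 1).factorial : ℕ) : k)⁻¹)) *
          (((e + 1).factorial : ℕ) : _ ⧸ J) = 1 := by
        rw [← map_natCast (Ideal.Quotient.mk J), ← map_natCast C, ← map_mul, ← map_mul,
          inv_mul_cancel₀ (by exact_mod_cast Nat.factorial_ne_zero _), map_one, map_one]
      have hb : Ideal.Quotient.mk J (ρ (pderiv j F)) = 0 := by
        rw [← one_mul (Ideal.Quotient.mk J (ρ (pderiv j F))), ← hc, mul_assoc, ha, mul_zero]
      exact Ideal.mem_comap.2 (Ideal.Quotient.eq_zero_iff_mem.1 hb)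
    · rintro _ ⟨s, rfl⟩
      exact h3 s
  rintro ⟨i, j⟩
  have h4 := hle (hN j)
  rw [Ideal.mem_comap, ← Ideal.Quotient.eq_zero_iff_mem] at h4
  rw [← Ideal.Quotient.eq_zero_iff_mem, map_pow, hx]
  simpa [ρ] using h4

theorem SST_count (n e Δ : ℕ) (k : Type) [Field k] [CharZero k] :
    ∃ c : ℕ, ∀ F : MvPolynomial (Fin n) ℤ, F.IsHomogeneous (e + 2) →
      ringKrullDim (MvPolynomial (Fin n) k ⧸ Ideal.span (Set.range fun j : Fin n =>
        pderiv j (map (Int.castRingHom k) F))) ≤ ((Δ : ℕ∞) : WithBot ℕ∞) →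
      ∀ (H : ℕ) (Xs : Finset (Fin (e + 1) → Fin n → ℤ)),
        (∀ h ∈ Xs, (∀ i j, |h i j| ≤ (H : ℤ)) ∧ ∀ j, SSTM (e + 1) (pderiv j F) h = 0) →
        Xs.card ≤ ((e + 1) * n * (2 * H + 1) + 1) ^ (e * n + Δ) * c := by
  classical
  obtain ⟨T0, hT0⟩ := SST_partB (Fin n ⊕ ((Fin e × Fin n) ⊕ Fin Δ)) (Fin (e + 1) × Fin n) k
    (Sum.elim (fun _ => e + 1) (fun _ => 1))
  refine ⟨Nat.card {m : (Fin (e + 1) × Fin n) →₀ ℕ // m.degree < T0}, ?_⟩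
  intro F hF hdim H Xs hXs
  set Fk := map (Int.castRingHom k) F with hFk
  have hFkh : Fk.IsHomogeneous (e + 2) := hF.map _
  have hder : ∀ j, (pderiv j Fk).IsHomogeneous (e + 1) := fun j => by
    simpa using hFkh.pderiv (i := j)
  obtain ⟨l, hl, N, hN⟩ := SST_partA Δ (Ideal.span (Set.range fun j : Fin n => pderiv j Fk))
    (SSTHom_span _ (by rintro _ ⟨j, rfl⟩; exact ⟨_, hder j⟩)) hdim
  let g : Fin n ⊕ ((Fin e × Fin n) ⊕ Fin Δ) → MvPolynomial (Fin (e + 1) × Fin n) k :=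
    Sum.elim (fun j => SSTM (e + 1) (map C (pderiv j Fk)) (fun i j => X (i, j)))
      (Sum.elim (fun ij => X (ij.1.succ, ij.2) - X (0, ij.2))
        (fun s => rename (fun j : Fin n => ((0 : Fin (e + 1)), j)) (l s)))
  have hg : ∀ s, (g s).IsHomogeneous
      (Sum.elim (fun _ => e + 1) (fun _ => 1) s) := by
    rintro (j | ⟨i, j⟩ | s)
    · exact SSTM_hom _ _ _ fun i j => isHomogeneous_X _ _
    · exact (isHomogeneous_X _ _).sub (isHomogeneous_X _ _)
    · exact (hl s).rename_isHomogeneous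
  have hpow := SST_nilp Fk hFkh l N hN (Ideal.span (Set.range g))
    (fun j => Ideal.subset_span ⟨Sum.inl j, rfl⟩)
    (fun i j => Ideal.subset_span ⟨Sum.inr (Sum.inl (i, j)), rfl⟩)
    (fun s => Ideal.subset_span ⟨Sum.inr (Sum.inr s), rfl⟩)
  obtain ⟨T, hT⟩ := SST_partB' _ g hg N hpow
  have hgood := hT0 g hg T hT
  let S : Finset k := (Finset.Icc (-(H : ℤ)) H).image (fun z : ℤ => (z : k))
  have hS : S.card ≤ 2 * H + 1 := by
    refine Finset.card_image_le.trans ?_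
    rw [Int.card_Icc]; omega
  let em : (Fin (e + 1) → Fin n → ℤ) → (Fin (e + 1) × Fin n → k) := fun h ij => (h ij.1 ij.2 : k)
  have hem : Function.Injective em := by
    intro h h' hh
    funext i j
    exact Int.cast_injective (α := k) (congrFun hh (i, j))
  have hC := SST_partC (fun _ => e + 1) g T0 hgood S (Xs.image em) (by
    intro x hx
    obtain ⟨h, hh, rfl⟩ := Finset.mem_image.1 hx
    obtain ⟨ha, hb⟩ := hXs h hh
    constructor
    · rintro ⟨i, j⟩
      exact Finset.mem_image.2 ⟨h i j, Finset.mem_Icc.2 (abs_le.1 (ha i j)), rfl⟩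
    · intro j
      change eval _ (SSTM (e + 1) (map C (pderiv j Fk)) (fun i j => X (i, j))) = 0
      rw [SSTM_eval]
      have h5 : (eval (em h)).comp C = RingHom.id k := by ext; simp
      rw [h5, MvPolynomial.map_id, hFk, pderiv_map]
      have h6 := SSTM_map (Int.castRingHom k) (e + 1) (pderiv j F) h
      rw [hb j, map_zero] at h6
      simpa [em] using h6)
  rw [Finset.card_image_of_injective _ hem] at hC
  refine hC.trans (Nat.mul_le_mul_right _ ?_)
  have : Fintype.card ((Fin e × Fin n) ⊕ Fin Δ) = e * n + Δ := by simp
  rw [this]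
  refine Nat.pow_le_pow_left ?_ _
  have : Fintype.card (Fin (e + 1) × Fin n) = (e + 1) * n := by simp
  rw [this]
  exact Nat.add_le_add_right (Nat.mul_le_mul_left _ hS) _

/-! ### Weyl differencing for complete sums -/

/-- translation of a polynomial -/
def SSTtau {n : ℕ} {A : Type} [CommRing A] (h : Fin n → A) :
    MvPolynomial (Fin n) A →ₐ[A] MvPolynomial (Fin n) A :=
  aeval (fun i => X i + C (h i))

/-- directional derivative -/
def SSTD {n : ℕ} {A : Type} [CommRing A] (h : Fin n → A) (p : MvPolynomial (Fin n) A) :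
    MvPolynomial (Fin n) A := ∑ l, C (h l) * pderiv l p

theorem SSTL_nil {n : ℕ} {A : Type} [CommRing A] {p : MvPolynomial (Fin n) A} (h : SSTL 0 p) :
    p = 0 := by
  ext s; rw [h s (Nat.zero_le _), coeff_zero]

theorem SSTD_mul_X {n : ℕ} {A : Type} [CommRing A] (h : Fin n → A) (p : MvPolynomial (Fin n) A)
    (i : Fin n) : SSTD h (p * X i) = SSTD h p * X i + C (h i) * p := by
  classical
  simp only [SSTD, Derivation.leibniz, pderiv_X, smul_eq_mul]
  simp only [mul_add, Finset.sum_add_distrib, Finset.sum_mul]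
  rw [add_comm]
  congr 1
  · exact Finset.sum_congr rfl fun _ _ => by ring
  · simp [Pi.single_apply]

theorem SSTD_add {n : ℕ} {A : Type} [CommRing A] (h : Fin n → A) (p p' : MvPolynomial (Fin n) A) :
    SSTD h (p + p') = SSTD h p + SSTD h p' := by
  simp [SSTD, mul_add, Finset.sum_add_distrib]

theorem SST_tau_mono {n : ℕ} {A : Type} [CommRing A] (h : Fin n → A) (s : Fin n →₀ ℕ) (a : A) :
    ∀ m, SSTL (m + 1) (monomial s a) →
      SSTL m (SSTtau h (monomial s a) - monomial s a) ∧
      SSTL (m - 1) (SSTtau h (monomial s a) - monomial s a - SSTD h (monomial s a)) := by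
  refine induction_on_monomial (motive := fun p => ∀ m, SSTL (m + 1) p →
      SSTL m (SSTtau h p - p) ∧ SSTL (m - 1) (SSTtau h p - p - SSTD h p)) ?_ ?_ s a
  · intro a m _
    have h1 : SSTtau h (C a) - C a = 0 := by simp [SSTtau]
    have h2 : SSTD h (C a) = 0 := by simp [SSTD]
    rw [h1, h2, sub_zero]
    exact ⟨SSTL_zero, SSTL_zero⟩
  · intro p i ih m hm
    have hp : SSTL m p := by
      intro t ht
      rw [← coeff_mul_X _ i p]
      apply hm
      rw [map_add, Finsupp.degree_single]; omega
    have e1 : SSTtau h (p * X i) - p * X i = X i * (SSTtau h p - p) + C (h i) * p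
        + C (h i) * (SSTtau h p - p) := by
      rw [map_mul]
      have : SSTtau h (X i) = X i + C (h i) := by simp [SSTtau]
      rw [this]; ring
    have e2 : SSTtau h (p * X i) - p * X i - SSTD h (p * X i) =
        X i * (SSTtau h p - p - SSTD h p) + C (h i) * (SSTtau h p - p) := by
      rw [SSTD_mul_X, e1]; ring
    rw [e2, e1]
    rcases m with _ | m
    · have := SSTL_nil hp
      subst this
      have h2 : SSTD h (0 : MvPolynomial (Fin n) A) = 0 := by simp [SSTD]
      simp only [map_zero, h2, sub_zero, mul_zero, add_zero]
      exact ⟨SSTL_zero, SSTL_zero⟩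
    · obtain ⟨i1, i2⟩ := ih m hp
      refine ⟨SSTL_add (SSTL_add (SSTL_X_mul i1 i) (SSTL_C_mul hp _))
        (SSTL_mono (SSTL_C_mul i1 _) (Nat.le_succ _)), ?_⟩
      refine SSTL_add ?_ (SSTL_C_mul i1 _)
      rcases m with _ | m
      · rw [SSTL_nil i2, mul_zero]; exact SSTL_zero
      · exact SSTL_X_mul i2 i

theorem SST_tau {n : ℕ} {A : Type} [CommRing A] (h : Fin n → A) (p : MvPolynomial (Fin n) A)
    (m : ℕ) (hp : SSTL (m + 1) p) :
      SSTL m (SSTtau h p - p) ∧ SSTL (m - 1) (SSTtau h p - p - SSTD h p) := by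
  have hm : ∀ s, SSTL (m + 1) (monomial s (coeff s p)) := by
    intro s t ht
    rw [coeff_monomial]
    split_ifs with hst
    · subst hst; exact hp _ ht
    · rfl
  have hD : SSTD h p = ∑ s ∈ p.support, SSTD h (monomial s (coeff s p)) := by
    conv_lhs => rw [p.as_sum]
    simp only [SSTD, map_sum, Finset.mul_sum]
    exact Finset.sum_comm
  have hT : SSTtau h p - p = ∑ s ∈ p.support, (SSTtau h (monomial s (coeff s p))
      - monomial s (coeff s p)) := by
    conv_lhs => rw [p.as_sum]
    simp only [map_sum, Finset.sum_sub_distrib]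
  rw [hD, hT, ← Finset.sum_sub_distrib]
  exact ⟨SSTL_sum _ _ fun s _ => (SST_tau_mono h s _ m (hm s)).1,
    SSTL_sum _ _ fun s _ => (SST_tau_mono h s _ m (hm s)).2⟩

theorem SST_eval_tau {n : ℕ} {A : Type} [CommRing A] (h x : Fin n → A)
    (p : MvPolynomial (Fin n) A) : eval x (SSTtau h p) = eval (x + h) p := by
  induction p using MvPolynomial.induction_on with
  | C a => simp [SSTtau]
  | add p q hp hq => rw [map_add, map_add, hp, hq, map_add]
  | mul_X p i hp => rw [map_mul, map_mul, hp, map_mul]; simp [SSTtau]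

/-- the complete exponential sum -/
def SSTS {n q : ℕ} [NeZero q] (p : MvPolynomial (Fin n) (ZMod q)) : ℂ :=
  ∑ x : Fin n → ZMod q, ZMod.stdAddChar (eval x p)

theorem SSTS_sq {n q : ℕ} [NeZero q] (p : MvPolynomial (Fin n) (ZMod q)) :
    ‖SSTS p‖ ^ 2 ≤ ∑ h : Fin n → ZMod q, ‖SSTS (SSTtau h p - p)‖ := by
  have h1 : ((‖SSTS p‖ ^ 2 : ℝ) : ℂ) = ∑ h : Fin n → ZMod q, SSTS (SSTtau h p - p) := by
    have h2 : ((‖SSTS p‖ ^ 2 : ℝ) : ℂ) = SSTS p * (starRingEnd ℂ) (SSTS p) := by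
      rw [Complex.mul_conj, Complex.normSq_eq_norm_sq]
    rw [h2]
    simp only [SSTS]
    rw [map_sum, Finset.sum_mul_sum, Finset.sum_comm]
    rw [Finset.sum_comm (s := (Finset.univ : Finset (Fin n → ZMod q)))
      (f := fun h x => ZMod.stdAddChar (eval x (SSTtau h p - p)))]
    refine Finset.sum_congr rfl fun x _ => ?_
    rw [← Equiv.sum_comp (Equiv.addLeft x)]
    refine Finset.sum_congr rfl fun h _ => ?_
    rw [map_sub, SST_eval_tau, sub_eq_add_neg, AddChar.map_add_eq_mul, AddChar.map_neg_eq_conj]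
    rfl
  have h3 : ‖SSTS p‖ ^ 2 = ‖((‖SSTS p‖ ^ 2 : ℝ) : ℂ)‖ := by
    rw [Complex.norm_real, Real.norm_of_nonneg (by positivity)]
  rw [h3, h1]
  exact norm_sum_le _ _

theorem SSTS_trivial {n q : ℕ} [NeZero q] (p : MvPolynomial (Fin n) (ZMod q)) :
    ‖SSTS p‖ ≤ Fintype.card (Fin n → ZMod q) := by
  refine (norm_sum_le _ _).trans ?_
  refine (Finset.sum_le_card_nsmul _ _ 1 fun x _ => ?_).trans ?_
  · rw [AddChar.norm_apply]
  · simp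

theorem SSTS_linear {n q : ℕ} [NeZero q] (p : MvPolynomial (Fin n) (ZMod q)) (hp : SSTL 2 p)
    (k : Fin n) (hk : coeff 0 (pderiv k p) ≠ 0) : SSTS p = 0 := by
  classical
  have h1 := SSTL_nil (SST_tau (Pi.single k 1) p 1 hp).2
  have h2 : SSTD (Pi.single k 1) p = C (coeff 0 (pderiv k p)) := by
    have : SSTD (Pi.single k 1) p = pderiv k p := by
      simp [SSTD, Pi.single_apply]
    rw [this]
    ext s
    rw [coeff_C]
    split_ifs with hs
    · rw [hs]
    · refine SSTL_pderiv hp k s ?_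
      rw [Nat.one_le_iff_ne_zero, Ne, Finsupp.degree_eq_zero_iff]
      exact fun h => hs h.symm
  have h3 : ∀ x, eval (x + Pi.single k 1) p = eval x p + coeff 0 (pderiv k p) := by
    intro x
    have := congrArg (eval x) h1
    rw [h2, map_sub, map_sub, SST_eval_tau, eval_C, map_zero] at this
    linear_combination this
  have h4 : SSTS p = SSTS p * ZMod.stdAddChar (coeff 0 (pderiv k p)) := by
    conv_lhs => rw [SSTS, ← Equiv.sum_comp (Equiv.addRight (Pi.single k 1))]
    rw [SSTS, Finset.sum_mul]
    refine Finset.sum_congr rfl fun x _ => ?_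
    rw [← AddChar.map_add_eq_mul, ← h3]
    rfl
  have h5 : (ZMod.stdAddChar (coeff 0 (pderiv k p)) : ℂ) ≠ 1 := by
    intro h
    apply hk
    apply ZMod.injective_stdAddChar
    rw [h, AddChar.map_zero_eq_one]
  have h6 : SSTS p * (ZMod.stdAddChar (coeff 0 (pderiv k p)) - 1) = 0 := by
    rw [mul_sub, ← h4]; simp
  exact (mul_eq_zero.1 h6).resolve_right (sub_ne_zero.2 h5)

theorem SST_pderiv_comm {n : ℕ} {A : Type} [CommRing A] (p : MvPolynomial (Fin n) A) (i j : Fin n) :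
    pderiv i (pderiv j p) = pderiv j (pderiv i p) := by
  classical
  ext s
  simp only [coeff_pderiv]
  by_cases h : i = j
  · subst h; rfl
  · have e : s + Finsupp.single i 1 + Finsupp.single j 1
      = s + Finsupp.single j 1 + Finsupp.single i 1 := by abel
    rw [e]
    simp [h, Ne.symm h]
    ring

theorem SST_card_cons {α : Type} [Fintype α] {r : ℕ} (P : (Fin (r + 1) → α) → Prop) :
    Nat.card {h // P h} = ∑ a : α, Nat.card {h' : Fin r → α // P (Fin.cons a h')} := by
  rw [← Nat.card_sigma]
  refine Nat.card_congr
    { toFun := fun h => ⟨h.1 0, ⟨fun i => h.1 i.succ, by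
        have : Fin.cons (h.1 0) (fun i => h.1 i.succ) = h.1 := Fin.cons_self_tail h.1
        rw [this]; exact h.2⟩⟩
      invFun := fun a => ⟨Fin.cons a.1 a.2.1, a.2.2⟩
      left_inv := fun h => Subtype.ext (Fin.cons_self_tail h.1)
      right_inv := fun a => rfl }

theorem SST_card_cons' {α β : Type} [Fintype α] [Fintype β] {r : ℕ}
    (P : α → (Fin r → β) → Prop) :
    ∑ a : α, Nat.card {h' : Fin r → β // P a h'} =
    ∑ h' : Fin r → β, Nat.card {a // P a h'} := by
  rw [← Nat.card_sigma, ← Nat.card_sigma]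
  exact Nat.card_congr
    { toFun := fun h => ⟨h.2.1, ⟨h.1, h.2.2⟩⟩
      invFun := fun h => ⟨h.2.1, ⟨h.1, h.2.2⟩⟩
      left_inv := fun h => rfl
      right_inv := fun a => rfl }

theorem SST_weyl {n q : ℕ} [NeZero q] (r : ℕ) : ∀ (p : MvPolynomial (Fin n) (ZMod q)),
    SSTL (r + 2) p →
    ‖SSTS p‖ ^ (2 ^ r) * (Fintype.card (Fin n → ZMod q) : ℝ) ^ r ≤
      (Fintype.card (Fin n → ZMod q) : ℝ) ^ (2 ^ r) *
      (Nat.card {h : Fin r → Fin n → ZMod q // ∀ k, SSTM r (pderiv k p) h = 0} : ℝ) := by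
  set G := (Fintype.card (Fin n → ZMod q) : ℝ) with hG
  have hG0 : 0 < G := by rw [hG]; exact_mod_cast Fintype.card_pos
  induction r with
  | zero =>
    intro p hp
    by_cases hk : ∀ k, coeff 0 (pderiv k p) = 0
    · have : Nat.card {h : Fin 0 → Fin n → ZMod q // ∀ k, SSTM 0 (pderiv k p) h = 0} = 1 := by
        rw [Nat.card_eq_one_iff_unique]
        exact ⟨inferInstance, ⟨⟨Fin.elim0, hk⟩⟩⟩
      rw [this]
      simp only [pow_zero, pow_one, mul_one, Nat.cast_one]
      exact SSTS_trivial p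
    · push Not at hk
      obtain ⟨k, hk⟩ := hk
      rw [SSTS_linear p hp k hk]
      simp only [norm_zero, pow_zero, pow_one, zero_mul]
      positivity
  | succ r ih =>
    intro p hp
    have h1 : ‖SSTS p‖ ^ (2 ^ (r + 1)) ≤ G ^ (2 ^ r - 1) *
        ∑ h : Fin n → ZMod q, ‖SSTS (SSTtau h p - p)‖ ^ (2 ^ r) := by
      rw [pow_succ, mul_comm, pow_mul]
      refine (pow_le_pow_left₀ (by positivity) (SSTS_sq p) _).trans ?_
      obtain ⟨w, hw⟩ := Nat.exists_eq_succ_of_ne_zero (pow_ne_zero r (two_ne_zero (α := ℕ)))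
      rw [hw]
      have h0 := pow_sum_div_card_le_sum_pow (s := (Finset.univ : Finset (Fin n → ZMod q)))
        (f := fun h => ‖SSTS (SSTtau h p - p)‖) (fun _ _ => norm_nonneg _) w
      rw [Finset.card_univ, ← hG, div_le_iff₀ (by positivity)] at h0
      rw [Nat.succ_sub_one, mul_comm (G ^ w)]
      exact h0
    have h2 : ∀ h : Fin n → ZMod q, ‖SSTS (SSTtau h p - p)‖ ^ (2 ^ r) * G ^ r ≤
        G ^ (2 ^ r) * (Nat.card {h' : Fin r → Fin n → ZMod q //
          ∀ k, SSTM (r + 1) (pderiv k p) (Fin.cons h h') = 0} : ℝ) := by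
      intro h
      obtain ⟨t1, t2⟩ := SST_tau h p (r + 2) hp
      have key : ∀ k h', SSTM r (pderiv k (SSTtau h p - p)) h' =
          SSTM (r + 1) (pderiv k p) (Fin.cons h h') := by
        intro k h'
        have e1 : pderiv k (SSTtau h p - p) = pderiv k (SSTtau h p - p - SSTD h p)
          + pderiv k (SSTD h p) := by rw [← map_add]; congr 1; ring
        rw [e1, SSTM_add, SSTM_L _ _ (SSTL_pderiv t2 k), zero_add]
        simp only [SSTM, SSTD, map_sum, SSTM_sum, Fin.cons_zero, Fin.cons_succ]
        refine Finset.sum_congr rfl fun l _ => ?_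
        rw [pderiv_C_mul, SSTM_C_mul, SST_pderiv_comm]
      have := ih _ t1
      simpa only [key] using this
    have h3 : (Nat.card {h : Fin (r + 1) → Fin n → ZMod q //
          ∀ k, SSTM (r + 1) (pderiv k p) h = 0} : ℝ) = ∑ h : Fin n → ZMod q,
        (Nat.card {h' : Fin r → Fin n → ZMod q //
          ∀ k, SSTM (r + 1) (pderiv k p) (Fin.cons h h') = 0} : ℝ) := by
      rw [SST_card_cons]
      push_cast
      rfl
    rw [h3, Finset.mul_sum]
    calc ‖SSTS p‖ ^ (2 ^ (r + 1)) * G ^ (r + 1) ≤ (G ^ (2 ^ r - 1) *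
        ∑ h : Fin n → ZMod q, ‖SSTS (SSTtau h p - p)‖ ^ (2 ^ r)) * G ^ (r + 1) := by gcongr
      _ = (G ^ (2 ^ r - 1) * G) * ∑ h : Fin n → ZMod q, ‖SSTS (SSTtau h p - p)‖ ^ (2 ^ r) * G ^ r := by
        rw [← Finset.sum_mul]; ring
      _ = G ^ (2 ^ r) * ∑ h : Fin n → ZMod q, ‖SSTS (SSTtau h p - p)‖ ^ (2 ^ r) * G ^ r := by
        rw [← pow_succ, Nat.sub_add_cancel Nat.one_le_two_pow]
      _ ≤ _ := by
        rw [Finset.mul_sum]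
        refine Finset.sum_le_sum fun h _ => ?_
        calc _ ≤ G ^ (2 ^ r) * _ := mul_le_mul_of_nonneg_left (h2 h) (by positivity)
          _ = _ := by rw [pow_succ 2 r, mul_two, pow_add]; ring

/-! ### From residues to a small box -/

theorem SST_pigeon {n q : ℕ} [NeZero q] (H : ℕ) (hH : 1 ≤ H)
    (Λ : AddSubgroup (Fin n → ZMod q)) :
    Nat.card {x // x ∈ Λ} ≤ (q / H + 1) ^ n *
      Nat.card {z : Fin n → Finset.Icc (-(H : ℤ)) H // (fun j => (((z j).1 : ℤ) : ZMod q)) ∈ Λ} := by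
  classical
  set B := {z : Fin n → Finset.Icc (-(H : ℤ)) H // (fun j => (((z j).1 : ℤ) : ZMod q)) ∈ Λ} with hB
  let φ : (Fin n → ZMod q) → (Fin n → Fin (q / H + 1)) := fun x j =>
    ⟨(x j).val / H, Nat.lt_succ_of_le (Nat.div_le_div_right (ZMod.val_lt _).le)⟩
  let s : Finset (Fin n → ZMod q) := Finset.univ.filter (· ∈ Λ)
  have hs : Nat.card {x // x ∈ Λ} = s.card := by
    rw [Nat.card_eq_fintype_card, Fintype.card_subtype]
  have hfib : ∀ b ∈ s.image φ, (s.filter (fun x => φ x = b)).card ≤ Nat.card B := by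
    intro b hb
    obtain ⟨x0, hx0, rfl⟩ := Finset.mem_image.1 hb
    have hx0' : x0 ∈ Λ := (Finset.mem_filter.1 hx0).2
    rw [← Nat.card_eq_finsetCard]
    have hmem : ∀ x : {x // x ∈ s.filter (fun x => φ x = φ x0)}, x.1 ∈ Λ ∧ φ x.1 = φ x0 := fun x =>
      ⟨(Finset.mem_filter.1 (Finset.mem_filter.1 x.2).1).2, (Finset.mem_filter.1 x.2).2⟩
    let F : {x // x ∈ s.filter (fun x => φ x = φ x0)} → B := fun x =>
      ⟨fun j => ⟨((x.1 j).val : ℤ) - ((x0 j).val : ℤ), by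
        have h1 : (x.1 j).val / H = (x0 j).val / H :=
          congrArg Fin.val (congrFun (hmem x).2 j)
        have h2 := Nat.div_add_mod (x.1 j).val H
        have h3 := Nat.div_add_mod (x0 j).val H
        have h4 := Nat.mod_lt (x.1 j).val hH
        have h5 := Nat.mod_lt (x0 j).val hH
        rw [h1] at h2
        rw [Finset.mem_Icc]
        constructor <;> omega⟩, by
        have : (fun j => ((((x.1 j).val : ℤ) - ((x0 j).val : ℤ) : ℤ) : ZMod q)) = x.1 - x0 := by
          funext j
          simp
        simp only [this]
        exact Λ.sub_mem (hmem x).1 hx0'⟩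
    refine Nat.card_le_card_of_injective F ?_
    intro x y hxy
    apply Subtype.ext
    funext j
    have h1 : ((x.1 j).val : ℤ) - ((x0 j).val : ℤ) = ((y.1 j).val : ℤ) - ((x0 j).val : ℤ) :=
      congrArg Subtype.val (congrFun (congrArg Subtype.val hxy) j)
    apply ZMod.val_injective
    omega
  rw [hs]
  refine (Finset.card_le_mul_card_image (f := φ) s _ hfib).trans ?_
  rw [mul_comm]
  refine Nat.mul_le_mul_right _ ?_
  refine (Finset.card_le_univ _).trans ?_
  simp

theorem SSTM_cons {n : ℕ} {A : Type} [CommRing A] (r : ℕ) (p : MvPolynomial (Fin n) A)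
    (a : Fin n → A) (h : Fin r → Fin n → A) :
    SSTM (r + 1) p (Fin.cons a h) = SSTM r (SSTD a p) h := by
  simp only [SSTM, SSTD, SSTM_sum, Fin.cons_zero, Fin.cons_succ, SSTM_C_mul]

theorem SST_box {n q : ℕ} [NeZero q] (H : ℕ) (hH : 1 ≤ H) (r : ℕ) :
    ∀ p : Fin n → MvPolynomial (Fin n) (ZMod q),
    Nat.card {h : Fin r → Fin n → ZMod q // ∀ k, SSTM r (p k) h = 0} ≤
      (q / H + 1) ^ (n * r) *
      Nat.card {z : Fin r → Fin n → Finset.Icc (-(H : ℤ)) H //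
        ∀ k, SSTM r (p k) (fun i j => (((z i j).1 : ℤ) : ZMod q)) = 0} := by
  induction r with
  | zero =>
    intro p
    rw [mul_zero, pow_zero, one_mul]
    by_cases hk : ∀ k, coeff 0 (p k) = 0
    · have h1 : Nat.card {h : Fin 0 → Fin n → ZMod q // ∀ k, SSTM 0 (p k) h = 0} = 1 := by
        rw [Nat.card_eq_one_iff_unique]
        exact ⟨inferInstance, ⟨⟨Fin.elim0, hk⟩⟩⟩
      rw [h1, Nat.one_le_iff_ne_zero, Nat.card_ne_zero]
      exact ⟨⟨⟨Fin.elim0, hk⟩⟩, inferInstance⟩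
    · have h1 : IsEmpty {h : Fin 0 → Fin n → ZMod q // ∀ k, SSTM 0 (p k) h = 0} :=
        ⟨fun h => hk h.2⟩
      rw [Nat.card_of_isEmpty]
      exact Nat.zero_le _
  | succ r ih =>
    intro p
    rw [SST_card_cons, SST_card_cons' (fun (a : Fin n → ZMod q) (h' : Fin r → Fin n → ZMod q) =>
      ∀ k, SSTM (r + 1) (p k) (Fin.cons a h') = 0)]
    have h1 : ∀ h' : Fin r → Fin n → ZMod q,
        Nat.card {a : Fin n → ZMod q // ∀ k, SSTM (r + 1) (p k) (Fin.cons a h') = 0} ≤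
        (q / H + 1) ^ n * Nat.card {z : Fin n → Finset.Icc (-(H : ℤ)) H //
          ∀ k, SSTM (r + 1) (p k) (Fin.cons (fun j => (((z j).1 : ℤ) : ZMod q)) h') = 0} := by
      intro h'
      let Λ : AddSubgroup (Fin n → ZMod q) :=
        { carrier := {a | ∀ k, SSTM (r + 1) (p k) (Fin.cons a h') = 0}
          add_mem' := by
            intro a b ha hb k
            have ha := ha k
            have hb := hb k
            simp only [SSTM, Fin.cons_zero, Fin.cons_succ, Pi.add_apply, add_mul,
              Finset.sum_add_distrib] at ha hb ⊢
            rw [ha, hb, add_zero]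
          zero_mem' := by
            intro k
            simp [SSTM]
          neg_mem' := by
            intro a ha k
            have ha := ha k
            simp only [SSTM, Fin.cons_zero, Fin.cons_succ, Pi.neg_apply, neg_mul,
              Finset.sum_neg_distrib] at ha ⊢
            rw [ha, neg_zero] }
      exact SST_pigeon H hH Λ
    refine (Finset.sum_le_sum fun h' _ => h1 h').trans ?_
    rw [← Finset.mul_sum, ← SST_card_cons' (fun (z : Fin n → Finset.Icc (-(H : ℤ)) H)
      (h' : Fin r → Fin n → ZMod q) =>
      ∀ k, SSTM (r + 1) (p k) (Fin.cons (fun j => (((z j).1 : ℤ) : ZMod q)) h') = 0),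
      SST_card_cons, mul_add, mul_one, pow_add, mul_comm ((q / H + 1) ^ (n * r)), mul_assoc]
    refine Nat.mul_le_mul_left _ ?_
    rw [Finset.mul_sum]
    refine Finset.sum_le_sum fun z _ => ?_
    have h2 := ih (fun k => SSTD (fun j => (((z j).1 : ℤ) : ZMod q)) (p k))
    simp only [← SSTM_cons] at h2
    refine h2.trans (Nat.mul_le_mul_left _ (le_of_eq ?_))
    refine Nat.card_congr (Equiv.subtypeEquivRight fun z' => forall_congr' fun k => ?_)
    have : (Fin.cons (fun j => (((z j).1 : ℤ) : ZMod q)) fun i j => (((z' i j).1 : ℤ) : ZMod q) :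
      Fin (r + 1) → Fin n → ZMod q) =
      fun i j => ((((Fin.cons z z' : Fin (r + 1) → Fin n → Finset.Icc (-(H : ℤ)) H) i j).1 : ℤ) : ZMod q) := by
      funext i j
      refine Fin.cases ?_ (fun i => ?_) i <;> simp
    rw [this]

/-! ### The determinant argument -/

theorem SST_det {R : ℕ} (V : Set (Fin R → ℤ)) (q : ℕ) (W : ℝ) (hV : ∀ v ∈ V, ∀ i, |((v i : ℤ) : ℝ)| ≤ W)
    (a : Fin R → ℤ) (ha : ∀ D : ℤ, (∀ i, (q : ℤ) ∣ D * a i) → (q : ℤ) ∣ D)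
    (hVa : ∀ v ∈ V, (q : ℤ) ∣ ∑ i, v i * a i) (hW : R.factorial * W ^ R < q) :
    ∃ b : Fin R → ℤ, b ≠ 0 ∧ ∀ v ∈ V, ∑ i, b i * v i = 0 := by
  classical
  let cst : (Fin R → ℤ) → (Fin R → ℚ) := fun v i => (v i : ℚ)
  by_cases htop : Submodule.span ℚ (cst '' V) = ⊤
  · exfalso
    obtain ⟨f, hf1, hf2, hf3⟩ := Submodule.exists_fun_fin_finrank_span_eq ℚ (cst '' V)
    have hr : Module.finrank ℚ (Submodule.span ℚ (cst '' V)) = R := by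
      rw [htop, finrank_top, Module.finrank_fin_fun]
    choose u hu1 hu2 using hf1
    let B : Matrix (Fin R) (Fin R) ℤ := fun i j => u (Fin.cast hr.symm i) j
    have hBdet : B.det ≠ 0 := by
      have h1 : LinearIndependent ℚ (fun i => (B.map (Int.castRingHom ℚ)) i) := by
        have h2 : (fun i => (B.map (Int.castRingHom ℚ)) i) = f ∘ Fin.cast hr.symm := by
          funext i j
          simp only [Function.comp, ← hu2]
          rfl
        rw [h2]
        exact hf3.comp _ (Fin.cast_injective _)
      have h3 := (Matrix.linearIndependent_rows_iff_isUnit (A := B.map (Int.castRingHom ℚ))).1 h1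
      rw [Matrix.isUnit_iff_isUnit_det, isUnit_iff_ne_zero] at h3
      intro h0
      apply h3
      rw [← RingHom.mapMatrix_apply, ← RingHom.map_det, h0, map_zero]
    have hdvd : (q : ℤ) ∣ B.det := by
      apply ha
      intro i
      have h1 : B.adjugate.mulVec (B.mulVec a) = B.det • a := by
        rw [Matrix.mulVec_mulVec, Matrix.adjugate_mul, Matrix.smul_mulVec, Matrix.one_mulVec]
      have h2 := congrFun h1 i
      rw [Pi.smul_apply, smul_eq_mul] at h2
      rw [← h2]
      have h6 : ∀ j, (q : ℤ) ∣ B.mulVec a j := fun j => hVa _ (hu1 _)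
      rw [Matrix.mulVec_eq_sum]
      rw [Finset.sum_apply]
      refine Finset.dvd_sum fun j _ => ?_
      simpa using Dvd.dvd.mul_left (h6 j) (B.adjugate i j)
    have hle := Int.le_of_dvd (abs_pos.2 hBdet) ((dvd_abs _ _).2 hdvd)
    have h4 : |((B.det : ℤ) : ℝ)| ≤ R.factorial * W ^ R := by
      have := Matrix.det_le (A := B.map (Int.castRingHom ℝ)) (abv := AbsoluteValue.abs) (x := W)
        (fun i j => hV _ (hu1 _) j)
      rw [← RingHom.mapMatrix_apply, ← RingHom.map_det] at this
      simpa using this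
    have h5 : (q : ℝ) ≤ |((B.det : ℤ) : ℝ)| := by exact_mod_cast hle
    linarith
  · obtain ⟨φ, hφ, hle⟩ := Submodule.exists_le_ker_of_lt_top _ (lt_top_iff_ne_top.2 htop)
    let c : Fin R → ℚ := fun i => φ (Pi.single i 1)
    have hφc : ∀ x, φ x = ∑ i, c i * x i := by
      intro x
      conv_lhs => rw [← Finset.univ_sum_single x]
      rw [map_sum]
      refine Finset.sum_congr rfl fun i _ => ?_
      have : Pi.single i (x i) = x i • (Pi.single i 1 : Fin R → ℚ) := by
        rw [← Pi.single_smul]; simp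
      rw [this, map_smul, smul_eq_mul, mul_comm]
    let D : ℕ := ∏ i, (c i).den
    have hD : D ≠ 0 := Finset.prod_ne_zero_iff.2 fun i _ => (c i).den_nz
    have hb : ∀ i, ∃ z : ℤ, (z : ℚ) = D * c i := by
      intro i
      obtain ⟨w, hw⟩ : (c i).den ∣ D := Finset.dvd_prod_of_mem _ (Finset.mem_univ i)
      refine ⟨w * (c i).num, ?_⟩
      rw [hw]
      push_cast
      have := Rat.mul_den_eq_num (c i)
      rw [← this]; ring
    choose b hb using hb
    refine ⟨b, ?_, ?_⟩
    · rintro rfl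
      apply hφ
      ext i
      have := hb i
      simp only [Pi.zero_apply, Int.cast_zero] at this
      have h1 : c i = 0 := by
        rcases mul_eq_zero.1 this.symm with h | h
        · exact absurd (by exact_mod_cast h) hD
        · exact h
      simpa [c] using h1
    · intro v hv
      have h1 : φ (cst v) = 0 := hle (Submodule.subset_span ⟨v, hv, rfl⟩)
      rw [hφc] at h1
      have h2 : ((∑ i, b i * v i : ℤ) : ℚ) = D * ∑ i, c i * cst v i := by
        push_cast
        rw [Finset.mul_sum]
        exact Finset.sum_congr rfl fun i _ => by rw [hb]; simp only [cst]; ring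
      rw [h1, mul_zero] at h2
      exact_mod_cast h2

/-! ### The bound for a single sum -/

theorem SSTL_sub_homComp {n m : ℕ} {p : MvPolynomial (Fin n) ℤ} (h : p.totalDegree = m) :
    SSTL m (p - homogeneousComponent m p) := by
  intro s hs
  rw [coeff_sub, coeff_homogeneousComponent]
  split_ifs with h1
  · rw [sub_self]
  · rw [sub_zero]
    exact (h ▸ SSTL_deg (p := p)) s (by omega)

theorem SST_boxcount (n R e Δ : ℕ) (k : Type) [Field k] [CharZero k] :
    ∃ c : ℕ, ∀ f : Fin R → MvPolynomial (Fin n) ℤ, (∀ i, (f i).totalDegree = e + 2) →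
      ∀ Ct : ℝ, 1 ≤ Ct →
      (∀ i m, |((coeff m (homogeneousComponent (e + 2) (f i)) : ℤ) : ℝ)| ≤ Ct) →
      (∀ b : Fin R → ℤ, b ≠ 0 →
        ringKrullDim (MvPolynomial (Fin n) k ⧸ Ideal.span (Set.range fun j : Fin n =>
          pderiv j (map (Int.castRingHom k) (∑ i, b i • homogeneousComponent (e + 2) (f i)))))
            ≤ ((Δ : ℕ∞) : WithBot ℕ∞)) →
      ∀ (q : ℕ) (a : Fin R → ℤ),
        (∀ D : ℤ, (∀ i, (q : ℤ) ∣ D * a i) → (q : ℤ) ∣ D) → ∀ H : ℕ,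
        R.factorial * (((e + 2) * Ct) * ((e + 1).factorial * (n : ℝ) ^ (e + 1) * (H : ℝ) ^ (e + 1))) ^ R
          < q →
        Nat.card {z : Fin (e + 1) → Fin n → Finset.Icc (-(H : ℤ)) H // ∀ k, SSTM (e + 1)
          (pderiv k (map (Int.castRingHom (ZMod q)) (∑ i, a i • f i)))
            (fun i j => (((z i j).1 : ℤ) : ZMod q)) = 0} ≤
        ((e + 1) * n * (2 * H + 1) + 1) ^ (e * n + Δ) * c := by
  classical
  obtain ⟨c, hc⟩ := SST_count n e Δ k
  refine ⟨c, ?_⟩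
  intro f hf Ct hCt hcoeff hdim q a ha H hq
  set Z := {z : Fin (e + 1) → Fin n → Finset.Icc (-(H : ℤ)) H // ∀ k, SSTM (e + 1)
          (pderiv k (map (Int.castRingHom (ZMod q)) (∑ i, a i • f i)))
            (fun i j => (((z i j).1 : ℤ) : ZMod q)) = 0} with hZ
  let co : (Fin (e + 1) → Fin n → Finset.Icc (-(H : ℤ)) H) → (Fin (e + 1) → Fin n → ℤ) :=
    fun z i j => (z i j).1
  have hco : Function.Injective co := fun z z' h => by
    funext i j
    exact Subtype.ext (congrFun (congrFun h i) j)
  let v : (Fin (e + 1) → Fin n → ℤ) → Fin n → Fin R → ℤ := fun z k i =>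
    SSTM (e + 1) (pderiv k (homogeneousComponent (e + 2) (f i))) z
  have hv : ∀ z k i, SSTM (e + 1) (pderiv k (f i)) z = v z k i := by
    intro z k i
    have e1 : pderiv k (f i) = pderiv k (f i - homogeneousComponent (e + 2) (f i))
      + pderiv k (homogeneousComponent (e + 2) (f i)) := by rw [← map_add, sub_add_cancel]
    rw [e1, SSTM_add, SSTM_L _ _ (SSTL_pderiv (SSTL_sub_homComp (hf i)) k), zero_add]
  have hbox : ∀ (z : Z) i j, |co z.1 i j| ≤ (H : ℤ) := fun z i j =>
    abs_le.2 (Finset.mem_Icc.1 (z.1 i j).2)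
  have lin : ∀ (b : Fin R → ℤ) (g : Fin R → MvPolynomial (Fin n) ℤ) k z,
      SSTM (e + 1) (pderiv k (∑ i, b i • g i)) z =
        ∑ i, b i * SSTM (e + 1) (pderiv k (g i)) z := by
    intro b g k z
    rw [map_sum, SSTM_sum]
    exact Finset.sum_congr rfl fun i _ => by rw [Derivation.map_smul, SSTM_smul]
  obtain ⟨b, hb0, hb⟩ := SST_det {w | ∃ (z : Z) (k : Fin n), w = v (co z.1) k} q
    (((e + 2) * Ct) * ((e + 1).factorial * (n : ℝ) ^ (e + 1) * (H : ℝ) ^ (e + 1)))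
    (by
      rintro _ ⟨z, k, rfl⟩ i
      refine SSTM_bound (e + 1) _ _ H (by positivity) (by positivity) ?_ _ ?_
      · intro s hs
        rw [coeff_pderiv]
        push_cast
        rw [abs_mul, mul_comm]
        refine mul_le_mul ?_ (hcoeff i _) (abs_nonneg _) (by positivity)
        have : s k ≤ e + 1 := hs ▸ Finsupp.le_degree k s
        rw [abs_of_nonneg (by positivity)]
        have : (s k : ℝ) ≤ e + 1 := by exact_mod_cast this
        linarith
      · intro i j
        exact_mod_cast hbox z i j)
    a ha
    (by
      rintro _ ⟨z, k, rfl⟩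
      have h1 := z.2 k
      rw [pderiv_map] at h1
      have h2 := SSTM_map (Int.castRingHom (ZMod q)) (e + 1) (pderiv k (∑ i, a i • f i)) (co z.1)
      simp only [eq_intCast] at h2
      have h3 : ((SSTM (e + 1) (pderiv k (∑ i, a i • f i)) (co z.1) : ℤ) : ZMod q) = 0 := by
        rw [← h2]; exact h1
      rw [ZMod.intCast_zmod_eq_zero_iff_dvd, lin] at h3
      simp only [hv] at h3
      simpa only [mul_comm] using h3) hq
  have hF : (∑ i, b i • homogeneousComponent (e + 2) (f i)).IsHomogeneous (e + 2) := by
    refine IsHomogeneous.sum _ _ _ fun i _ => ?_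
    exact Submodule.smul_mem (homogeneousSubmodule (Fin n) ℤ (e + 2)) (b i)
      (homogeneousComponent_isHomogeneous (e + 2) (f i))
  have hfin := hc _ hF (hdim b hb0) H (Finset.univ.image fun z : Z => co z.1) (by
    intro h hh
    obtain ⟨z, -, rfl⟩ := Finset.mem_image.1 hh
    refine ⟨hbox z, fun j => ?_⟩
    rw [lin]
    exact hb _ ⟨z, j, rfl⟩)
  have hinj : Function.Injective (fun z : Z => co z.1) := hco.comp Subtype.val_injective
  rw [Finset.card_image_of_injective _ hinj, Finset.card_univ] at hfin
  rwa [Nat.card_eq_fintype_card]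

theorem SST_bound1 (n R e Δ : ℕ) (k : Type) [Field k] [CharZero k] :
    ∃ c : ℝ, 0 < c ∧ ∀ f : Fin R → MvPolynomial (Fin n) ℤ, (∀ i, (f i).totalDegree = e + 2) →
      ∀ Ct : ℝ, 1 ≤ Ct →
      (∀ i m, |((coeff m (homogeneousComponent (e + 2) (f i)) : ℤ) : ℝ)| ≤ Ct) →
      (∀ b : Fin R → ℤ, b ≠ 0 →
        ringKrullDim (MvPolynomial (Fin n) k ⧸ Ideal.span (Set.range fun j : Fin n =>
          pderiv j (map (Int.castRingHom k) (∑ i, b i • homogeneousComponent (e + 2) (f i)))))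
            ≤ ((Δ : ℕ∞) : WithBot ℕ∞)) →
      ∀ (q : ℕ) [NeZero q] (a : Fin R → ℤ),
        (∀ D : ℤ, (∀ i, (q : ℤ) ∣ D * a i) → (q : ℤ) ∣ D) → ∀ H : ℕ, 1 ≤ H → H ≤ q →
        R.factorial * (((e + 2) * Ct) * ((e + 1).factorial * (n : ℝ) ^ (e + 1) * (H : ℝ) ^ (e + 1))) ^ R
          < q →
        ‖SSTS (map (Int.castRingHom (ZMod q)) (∑ i, a i • f i))‖ ^ (2 ^ (e + 1)) * (H : ℝ) ^ n ≤
          c * ((q : ℝ) ^ n) ^ (2 ^ (e + 1)) * (H : ℝ) ^ Δ := by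
  obtain ⟨c, hc⟩ := SST_boxcount n R e Δ k
  refine ⟨2 ^ (n * (e + 1)) * ((((e + 1) * n * 3 + 1 : ℕ) : ℝ) ^ (e * n + Δ) * (c + 1)), by positivity, ?_⟩
  intro f hf Ct hCt hcoeff hdim q _ a ha H hH hHq hq
  have h1 := hc f hf Ct hCt hcoeff hdim q a ha H hq
  have h2 := SST_box (q := q) H hH (e + 1)
    (fun k => pderiv k (map (Int.castRingHom (ZMod q)) (∑ i, a i • f i)))
  have hL : SSTL (e + 1 + 2) (map (Int.castRingHom (ZMod q)) (∑ i, a i • f i)) := by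
    refine SSTL_map _ (SSTL_sum _ _ fun i _ => ?_)
    have : a i • f i = C (a i) * f i := by rw [smul_eq_C_mul]
    rw [this]
    refine SSTL_C_mul ?_ _
    have := SSTL_deg (p := f i)
    rwa [hf i] at this
  have h3 := SST_weyl (e + 1) _ hL
  set S := ‖SSTS (map (Int.castRingHom (ZMod q)) (∑ i, a i • f i))‖
  have hcard : (Fintype.card (Fin n → ZMod q) : ℝ) = (q : ℝ) ^ n := by simp
  rw [hcard] at h3
  have hq0 : (0 : ℝ) < q := by exact_mod_cast Nat.pos_of_ne_zero (NeZero.ne q)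
  have hH0 : (0 : ℝ) < H := by exact_mod_cast hH
  have hdiv : ((q / H + 1 : ℕ) : ℝ) ≤ 2 * q / H := by
    push_cast
    have h4 : ((q / H : ℕ) : ℝ) ≤ (q : ℝ) / H := Nat.cast_div_le
    have h5 : (1 : ℝ) ≤ (q : ℝ) / H := by
      rw [one_le_div hH0]; exact_mod_cast hHq
    have : 2 * (q : ℝ) / H = q / H + q / H := by ring
    linarith
  have hbx : (((e + 1) * n * (2 * H + 1) + 1 : ℕ) : ℝ) ≤ (((e + 1) * n * 3 + 1 : ℕ) : ℝ) * H := by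
    have : (e + 1) * n * (2 * H + 1) + 1 ≤ ((e + 1) * n * 3 + 1) * H := by
      have : (e + 1) * n * (2 * H + 1) ≤ (e + 1) * n * (3 * H) := Nat.mul_le_mul_left _ (by omega)
      nlinarith
    exact_mod_cast this
  have hN : (Nat.card {h : Fin (e + 1) → Fin n → ZMod q // ∀ k, SSTM (e + 1)
      (pderiv k (map (Int.castRingHom (ZMod q)) (∑ i, a i • f i))) h = 0} : ℝ) ≤
      (2 * q / H) ^ (n * (e + 1)) * (((((e + 1) * n * 3 + 1 : ℕ) : ℝ) * H) ^ (e * n + Δ) * (c + 1)) := by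
    have h6 : (Nat.card {h : Fin (e + 1) → Fin n → ZMod q // ∀ k, SSTM (e + 1)
      (pderiv k (map (Int.castRingHom (ZMod q)) (∑ i, a i • f i))) h = 0} : ℝ) ≤
      ((q / H + 1 : ℕ) : ℝ) ^ (n * (e + 1)) *
        ((((e + 1) * n * (2 * H + 1) + 1 : ℕ) : ℝ) ^ (e * n + Δ) * c) := by
      exact_mod_cast h2.trans (Nat.mul_le_mul_left _ h1)
    refine h6.trans ?_
    gcongr
    linarith
  have h7 := h3.trans (mul_le_mul_of_nonneg_left hN (by positivity))
  have hpos : (0 : ℝ) < (q : ℝ) ^ (n * (e + 1)) * (H : ℝ) ^ (e * n) := by positivity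
  refine le_of_mul_le_mul_right ?_ hpos
  set Q := (((e + 1) * n * 3 + 1 : ℕ) : ℝ)
  have e1 : S ^ 2 ^ (e + 1) * (H : ℝ) ^ n * ((q : ℝ) ^ (n * (e + 1)) * (H : ℝ) ^ (e * n)) =
      (S ^ 2 ^ (e + 1) * ((q : ℝ) ^ n) ^ (e + 1)) * (H : ℝ) ^ (n * (e + 1)) := by
    rw [← pow_mul]
    have : (H : ℝ) ^ (n * (e + 1)) = H ^ n * H ^ (e * n) := by rw [← pow_add]; ring_nf
    rw [this]; ring
  rw [e1]
  refine (mul_le_mul_of_nonneg_right h7 (by positivity)).trans (le_of_eq ?_)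
  rw [div_pow, mul_pow, mul_pow, pow_add (H : ℝ)]
  field_simp

theorem SST_bound2 (n R e Δ : ℕ) (hR : 0 < R) (hΔ : Δ < n) (k : Type) [Field k] [CharZero k] :
    ∃ c : ℝ, 0 < c ∧ ∀ f : Fin R → MvPolynomial (Fin n) ℤ, (∀ i, (f i).totalDegree = e + 2) →
      ∀ Ct : ℝ, 1 ≤ Ct →
      (∀ i m, |((coeff m (homogeneousComponent (e + 2) (f i)) : ℤ) : ℝ)| ≤ Ct) →
      (∀ b : Fin R → ℤ, b ≠ 0 →
        ringKrullDim (MvPolynomial (Fin n) k ⧸ Ideal.span (Set.range fun j : Fin n =>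
          pderiv j (map (Int.castRingHom k) (∑ i, b i • homogeneousComponent (e + 2) (f i)))))
            ≤ ((Δ : ℕ∞) : WithBot ℕ∞)) →
      ∀ K : ℝ, K = ((n : ℝ) - Δ) / 2 ^ (e + 1) →
      ∀ (q : ℕ) [NeZero q] (a : Fin R → ℤ),
        (∀ D : ℤ, (∀ i, (q : ℤ) ∣ D * a i) → (q : ℤ) ∣ D) →
        ‖SSTS (map (Int.castRingHom (ZMod q)) (∑ i, a i • f i))‖ ≤
          c * (q : ℝ) ^ n * Ct ^ (K / ((e : ℝ) + 1)) * (q : ℝ) ^ (-(K / ((R : ℝ) * ((e : ℝ) + 1)))) := by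
  obtain ⟨c, hc0, hc⟩ := SST_bound1 n R e Δ k
  have hn : 0 < n := by omega
  have hn' : (1 : ℝ) ≤ n := by exact_mod_cast hn
  have hR' : (0 : ℝ) < R := by exact_mod_cast hR
  set N := n - Δ with hNdef
  set m := 2 ^ (e + 1) with hm
  have hm0 : m ≠ 0 := pow_ne_zero _ two_ne_zero
  have hm' : (0 : ℝ) < m := by exact_mod_cast Nat.pos_of_ne_zero hm0
  obtain ⟨K, hK⟩ : ∃ K : ℝ, K = ((n : ℝ) - Δ) / 2 ^ (e + 1) := ⟨_, rfl⟩
  have hKN : K = (N : ℝ) / m := by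
    rw [hK, hNdef, hm, Nat.cast_sub hΔ.le]; push_cast; rfl
  have hK0 : 0 ≤ K := by rw [hKN]; positivity
  set κ : ℝ := R.factorial * (((e : ℝ) + 2) * ((e + 1).factorial * (n : ℝ) ^ (e + 1))) ^ R with hκ
  have hκ1 : 1 ≤ κ := by
    have h1 : (1 : ℝ) ≤ R.factorial := by exact_mod_cast Nat.one_le_iff_ne_zero.2 (Nat.factorial_ne_zero _)
    have h2 : (1 : ℝ) ≤ (e + 1).factorial := by
      exact_mod_cast Nat.one_le_iff_ne_zero.2 (Nat.factorial_ne_zero _)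
    have h3 : (1 : ℝ) ≤ (n : ℝ) ^ (e + 1) := one_le_pow₀ hn'
    have h4 : (1 : ℝ) ≤ (e : ℝ) + 2 := by
      have : (0 : ℝ) ≤ e := by positivity
      linarith
    have h5 := one_le_mul_of_one_le_of_one_le h4 (one_le_mul_of_one_le_of_one_le h2 h3)
    exact one_le_mul_of_one_le_of_one_le h1 (one_le_pow₀ h5)
  set t : ℝ := 1 / (R * ((e : ℝ) + 1)) with ht
  have ht0 : 0 < t := by positivity
  set c' : ℝ := 1 + c ^ (1 / (m : ℝ)) * 2 ^ K with hc'
  refine ⟨c' * (2 * κ) ^ (t * K), by positivity, ?_⟩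
  intro f hf Ct hCt hcoeff hdim K' hK' q _ a ha
  have hKK : K' = K := by rw [hK', hK]
  rw [hKK]
  clear hKK hK'
  have hq0 : (0 : ℝ) < q := by exact_mod_cast Nat.pos_of_ne_zero (NeZero.ne q)
  have hCt0 : (0 : ℝ) < Ct := by linarith
  set S := ‖SSTS (map (Int.castRingHom (ZMod q)) (∑ i, a i • f i))‖ with hS
  set x : ℝ := (q / (2 * κ * Ct ^ R)) ^ t with hx
  have hx0 : 0 < x := by positivity
  have hxK : x ^ (-K) = (2 * κ) ^ (t * K) * Ct ^ (K / ((e : ℝ) + 1)) *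
      (q : ℝ) ^ (-(K / ((R : ℝ) * ((e : ℝ) + 1)))) := by
    rw [hx, ← Real.rpow_mul (by positivity), Real.div_rpow (by positivity) (by positivity),
      Real.mul_rpow (by positivity) (by positivity), ← Real.rpow_natCast, ← Real.rpow_mul hCt0.le]
    have e1 : t * -K = -(K / ((R : ℝ) * ((e : ℝ) + 1))) := by rw [ht]; ring
    have e2 : (R : ℝ) * (t * -K) = -(K / ((e : ℝ) + 1)) := by rw [ht]; field_simp
    have e3 : t * -K = -(t * K) := by ring
    rw [e2, Real.rpow_neg hCt0.le, ← e1, e3, Real.rpow_neg (x := 2 * κ) (by positivity)]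
    field_simp
  have htriv : S ≤ (q : ℝ) ^ n := by
    refine (SSTS_trivial _).trans (le_of_eq ?_)
    simp
  have key : S ≤ c' * (q : ℝ) ^ n * x ^ (-K) := by
    rcases lt_or_ge x 1 with hx1 | hx1
    · have h1 : 1 ≤ x ^ (-K) := Real.one_le_rpow_of_pos_of_le_one_of_nonpos hx0 hx1.le (by linarith)
      have h2 : 1 ≤ c' := by
        rw [hc']
        have : 0 ≤ c ^ (1 / (m : ℝ)) * 2 ^ K := by positivity
        linarith
      calc S ≤ 1 * (q : ℝ) ^ n * 1 := by simpa using htriv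
        _ ≤ _ := by gcongr
    · set H := ⌊x⌋₊ with hH
      have hH1 : 1 ≤ H := Nat.one_le_floor_iff _ |>.2 hx1
      have hHx : (H : ℝ) ≤ x := Nat.floor_le hx0.le
      have hH0 : (0 : ℝ) < H := by exact_mod_cast hH1
      have hxH : x / 2 ≤ H := by
        have h1 := Nat.lt_floor_add_one x
        have h2 : (1 : ℝ) ≤ H := by exact_mod_cast hH1
        rw [← hH] at h1
        linarith
      have hxp : x ^ (R * (e + 1)) = q / (2 * κ * Ct ^ R) := by
        rw [hx, ← Real.rpow_natCast, ← Real.rpow_mul (by positivity)]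
        have : t * ((R * (e + 1) : ℕ) : ℝ) = 1 := by
          rw [ht]; push_cast; field_simp
        rw [this, Real.rpow_one]
      have hcond : R.factorial * (((e + 2) * Ct) *
          ((e + 1).factorial * (n : ℝ) ^ (e + 1) * (H : ℝ) ^ (e + 1))) ^ R < q := by
        have e1 : R.factorial * (((e + 2) * Ct) *
          ((e + 1).factorial * (n : ℝ) ^ (e + 1) * (H : ℝ) ^ (e + 1))) ^ R =
          κ * Ct ^ R * (H : ℝ) ^ (R * (e + 1)) := by
          rw [hκ, mul_comm R (e + 1), pow_mul]
          simp only [mul_pow]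
          ring
        rw [e1]
        calc κ * Ct ^ R * (H : ℝ) ^ (R * (e + 1)) ≤ κ * Ct ^ R * x ^ (R * (e + 1)) := by gcongr
          _ = q / 2 := by rw [hxp]; field_simp
          _ < q := by linarith
      have hHq : H ≤ q := by
        have h1 : x ^ (R * (e + 1)) ≤ q := by
          rw [hxp]
          apply div_le_self hq0.le
          have : 1 ≤ Ct ^ R := one_le_pow₀ hCt
          nlinarith
        have h2 : x ≤ x ^ (R * (e + 1)) := le_self_pow₀ hx1 (by positivity)
        have : (H : ℝ) ≤ q := by linarith
        exact_mod_cast this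
      have hb := hc f hf Ct hCt hcoeff hdim q a ha H hH1 hHq hcond
      have hb2 : S ^ m * (x / 2) ^ N ≤ c * ((q : ℝ) ^ n) ^ m := by
        have h1 : S ^ m * (H : ℝ) ^ N ≤ c * ((q : ℝ) ^ n) ^ m := by
          have h2 : (H : ℝ) ^ n = H ^ N * H ^ Δ := by
            rw [← pow_add, hNdef, Nat.sub_add_cancel hΔ.le]
          rw [h2, ← mul_assoc] at hb
          exact le_of_mul_le_mul_right hb (by positivity)
        refine le_trans ?_ h1
        have : 0 ≤ S := norm_nonneg _
        gcongr
      have hb3 : S ≤ c ^ (1 / (m : ℝ)) * (q : ℝ) ^ n * (x / 2) ^ (-K) := by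
        refine (pow_le_pow_iff_left₀ (norm_nonneg _) (by positivity) hm0).1 ?_
        rw [mul_pow, mul_pow, ← Real.rpow_natCast (c ^ (1 / (m : ℝ))), ← Real.rpow_mul hc0.le,
          one_div_mul_cancel hm'.ne', Real.rpow_one, ← Real.rpow_natCast ((x / 2) ^ (-K)),
          ← Real.rpow_mul (by positivity)]
        have : -K * (m : ℝ) = -(N : ℝ) := by rw [hKN]; field_simp
        rw [this, Real.rpow_neg (by positivity), Real.rpow_natCast, ← div_eq_mul_inv,
          le_div_iff₀ (by positivity)]
        exact hb2
      refine hb3.trans ?_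
      have e1 : (x / 2) ^ (-K) = 2 ^ K * x ^ (-K) := by
        rw [Real.div_rpow hx0.le (by norm_num), Real.rpow_neg (x := 2) (by norm_num)]
        field_simp
      rw [e1]
      have e2 : c ^ (1 / (m : ℝ)) * (q : ℝ) ^ n * (2 ^ K * x ^ (-K)) =
        (c ^ (1 / (m : ℝ)) * 2 ^ K) * (q : ℝ) ^ n * x ^ (-K) := by ring
      rw [e2]
      gcongr
      rw [hc']; linarith
  refine key.trans (le_of_eq ?_)
  rw [hxK]; ring

theorem SST_gauss {n R : ℕ} (f : Fin R → MvPolynomial (Fin n) ℤ) (q : ℕ) [NeZero q] (a : Fin R → ℤ) :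
    Sgauss f q a = SSTS (map (Int.castRingHom (ZMod q)) (∑ i, a i • f i)) := by
  have hbij : Function.Bijective (fun (x : Fin n → Fin q) (j : Fin n) => ((x j : ℕ) : ZMod q)) := by
    rw [Fintype.bijective_iff_injective_and_card]
    constructor
    · intro x y hxy
      funext j
      have h1 := congrArg ZMod.val (congrFun hxy j)
      simp only [ZMod.val_natCast, Nat.mod_eq_of_lt (x j).2, Nat.mod_eq_of_lt (y j).2] at h1
      exact Fin.ext h1
    · simp
  rw [Sgauss, SSTS]
  refine Fintype.sum_bijective _ hbij _ _ fun x => ?_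
  have h1 : eval (fun j => ((x j : ℕ) : ZMod q)) (map (Int.castRingHom (ZMod q)) (∑ i, a i • f i)) =
      ((∑ i, a i * eval (fun j => ((x j : ℕ) : ℤ)) (f i) : ℤ) : ZMod q) := by
    have h2 : (fun j => ((x j : ℕ) : ZMod q)) = fun j => Int.castRingHom (ZMod q) ((x j : ℕ) : ℤ) := by
      funext j; simp
    rw [h2, eval_map]
    have h3 := eval₂_comp_left (Int.castRingHom (ZMod q)) (RingHom.id ℤ) (fun j => ((x j : ℕ) : ℤ))
      (∑ i, a i • f i)
    rw [RingHom.comp_id] at h3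
    change eval₂ (Int.castRingHom (ZMod q)) (Int.castRingHom (ZMod q) ∘ fun j => ((x j : ℕ) : ℤ)) _ = _
    rw [← h3]
    rw [eval₂_id, map_sum]
    simp
  rw [h1, ZMod.stdAddChar_coe, eC]
  congr 1
  push_cast
  ring

theorem SST_eC_norm (t : ℝ) : ‖eC t‖ = 1 := by
  rw [eC]
  have : 2 * (Real.pi : ℂ) * Complex.I * (t : ℂ) = ((2 * Real.pi * t : ℝ) : ℂ) * Complex.I := by
    push_cast; ring
  rw [this, Complex.norm_exp_ofReal_mul_I]

theorem SST_coprime {R q : ℕ} (a : Fin R → ℕ) (h : Nat.gcd (Finset.univ.gcd a) q = 1) :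
    ∀ D : ℤ, (∀ i, (q : ℤ) ∣ D * ((a i : ℕ) : ℤ)) → (q : ℤ) ∣ D := by
  intro D hD
  have h1 : ∀ i, q ∣ D.natAbs * a i := by
    intro i
    have := Int.natAbs_dvd_natAbs.2 (hD i)
    simpa [Int.natAbs_mul] using this
  have h2 : q ∣ Finset.univ.gcd (fun i => D.natAbs * a i) := Finset.dvd_gcd fun i _ => h1 i
  rw [Finset.gcd_mul_left, normalize_eq] at h2
  have h3 : q ∣ D.natAbs := Nat.Coprime.dvd_of_dvd_mul_right (Nat.Coprime.symm h) h2
  exact Int.natCast_dvd.2 h3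

theorem SST_term (n R e Δ : ℕ) (hR : 0 < R) (hΔ : Δ < n) :
    ∃ c : ℝ, 0 < c ∧ ∀ f : Fin R → MvPolynomial (Fin n) ℤ, (∀ i, (f i).totalDegree = e + 2) →
      ∀ Ct : ℝ, 1 ≤ Ct →
      coeffMax (fun i => homogeneousComponent (e + 2) (f i)) Ct →
      ((Δ : ℕ∞) : WithBot ℕ∞) = birchDelta n R (fun i => homogeneousComponent (e + 2) (f i)) →
      ∀ K : ℝ, K = ((n : ℝ) - Δ) / 2 ^ (e + 1) →
      ∀ (q : ℕ), 0 < q → ∀ ν : Fin R → ℤ,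
        ((q : ℝ) ^ n)⁻¹ * ∑ a ∈ resSet R q q,
                ‖SgaussNu f q (fun i => ((a i : ℕ) : ℤ) + 1) ν‖ ≤
          c * Ct ^ (K / ((e : ℝ) + 1)) * (q : ℝ) ^ ((R : ℝ) - (K / ((R : ℝ) * ((e : ℝ) + 1)))) := by
  obtain ⟨c, hc0, hc⟩ := SST_bound2 n R e Δ hR hΔ Qbar
  refine ⟨c, hc0, ?_⟩
  intro f hf Ct hCt hmax hdel K hK q hq ν
  have : NeZero q := ⟨hq.ne'⟩
  have hq0 : (0 : ℝ) < q := by exact_mod_cast hq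
  have hb := hc f hf Ct hCt (fun i m => hmax.2 ⟨i, m, rfl⟩) (fun b hb => by
    rw [hdel]
    exact le_iSup₂ (f := fun (b : Fin R → ℤ) (_ : b ≠ 0) => singDim n (map (Int.castRingHom Qbar)
      (∑ i, b i • homogeneousComponent (e + 2) (f i)))) b hb) K hK q
  have h1 : ∀ a ∈ resSet R q q, ‖SgaussNu f q (fun i => ((a i : ℕ) : ℤ) + 1) ν‖ ≤
      c * (q : ℝ) ^ n * Ct ^ (K / ((e : ℝ) + 1)) * (q : ℝ) ^ (-(K / ((R : ℝ) * ((e : ℝ) + 1)))) := by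
    intro a ha
    rw [SgaussNu, norm_mul, SST_eC_norm, mul_one, SST_gauss]
    apply hb
    have h2 := SST_coprime (fun i => (a i : ℕ) + 1) (Finset.mem_filter.1 ha).2
    simpa using h2
  have h2 := Finset.sum_le_card_nsmul _ _ _ h1
  have h3 : ((resSet R q q).card : ℝ) ≤ (q : ℝ) ^ R := by
    have : (resSet R q q).card ≤ q ^ R := by
      refine (Finset.card_le_univ _).trans ?_
      simp
    exact_mod_cast this
  rw [nsmul_eq_mul] at h2
  calc _ ≤ ((q : ℝ) ^ n)⁻¹ * ((q : ℝ) ^ R * (c * (q : ℝ) ^ n * Ct ^ (K / ((e : ℝ) + 1)) *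
        (q : ℝ) ^ (-(K / ((R : ℝ) * ((e : ℝ) + 1)))))) := by
        refine mul_le_mul_of_nonneg_left (h2.trans ?_) (by positivity)
        exact mul_le_mul_of_nonneg_right h3 (by positivity)
    _ = _ := by
        rw [sub_eq_add_neg, Real.rpow_add hq0, Real.rpow_natCast]
        field_simp

/-- **Lemma 2.10 (tail of the singular series).** -/
theorem singular_series_tail (n R d : ℕ) (hR : 0 < R) (hd : 2 ≤ d) (hnR : R < n)
    (η δ : ℝ) (hη : 0 < η) (hδ : 0 < δ) :
    ∃ c : ℝ, 0 < c ∧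
      ∀ (f : Fin R → MvPolynomial (Fin n) ℤ),
        (∀ i, (f i).totalDegree = d) →
        ∀ Ct K : ℝ, 1 ≤ Ct →
        coeffMax (fun i => MvPolynomial.homogeneousComponent d (f i)) Ct →
        KofDelta n R d (fun i => MvPolynomial.homogeneousComponent d (f i)) K →
        δ / η < K / ((R : ℝ) * ((d : ℝ) - 1)) - ((R : ℝ) + 1) →
        ∀ τ P : ℝ, 0 ≤ τ → 1 ≤ P → ∀ ν : Fin R → ℤ,
          (∑' q : {q : ℕ // P ^ (τ * η) < (q : ℝ)},
              ((q.1 : ℝ) ^ n)⁻¹ * ∑ a ∈ resSet R q.1 q.1,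
                ‖SgaussNu f q.1 (fun i => ((a i : ℕ) : ℤ) + 1) ν‖) ≤
            c * Ct ^ (K / ((d : ℝ) - 1)) * P ^ (-(τ * δ)) := by
  obtain ⟨e, rfl⟩ : ∃ e, d = e + 2 := ⟨d - 2, by omega⟩
  have hterm : ∀ Δ : ℕ, ∃ c : ℝ, 0 < c ∧ (Δ < n → ∀ f : Fin R → MvPolynomial (Fin n) ℤ,
      (∀ i, (f i).totalDegree = e + 2) →
      ∀ Ct : ℝ, 1 ≤ Ct →
      coeffMax (fun i => homogeneousComponent (e + 2) (f i)) Ct →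
      ((Δ : ℕ∞) : WithBot ℕ∞) = birchDelta n R (fun i => homogeneousComponent (e + 2) (f i)) →
      ∀ K : ℝ, K = ((n : ℝ) - Δ) / 2 ^ (e + 1) →
      ∀ (q : ℕ), 0 < q → ∀ ν : Fin R → ℤ,
        ((q : ℝ) ^ n)⁻¹ * ∑ a ∈ resSet R q q,
                ‖SgaussNu f q (fun i => ((a i : ℕ) : ℤ) + 1) ν‖ ≤
          c * Ct ^ (K / ((e : ℝ) + 1)) *
            (q : ℝ) ^ ((R : ℝ) - (K / ((R : ℝ) * ((e : ℝ) + 1))))) := by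
    intro Δ
    by_cases h : Δ < n
    · obtain ⟨c, hc0, hc⟩ := SST_term n R e Δ hR h
      exact ⟨c, hc0, fun _ => hc⟩
    · exact ⟨1, one_pos, fun h' => absurd h' h⟩
  choose c hc0 hc using hterm
  let u : ℕ → ℝ := fun Δ => ((n : ℝ) - Δ) / 2 ^ (e + 1) / ((R : ℝ) * ((e : ℝ) + 1)) - R - δ / η
  let Z : ℕ → ℝ := fun Δ => ∑' q : ℕ, (q : ℝ) ^ (-(u Δ))
  have hZ0 : ∀ Δ, 0 ≤ Z Δ := fun Δ => tsum_nonneg fun q => by positivity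
  refine ⟨1 + ∑ Δ ∈ Finset.range n, c Δ * Z Δ, ?_, ?_⟩
  · have : 0 ≤ ∑ Δ ∈ Finset.range n, c Δ * Z Δ :=
      Finset.sum_nonneg fun Δ _ => mul_nonneg (hc0 Δ).le (hZ0 Δ)
    linarith
  intro f hf Ct K hCt hmax hK hcond τ P hτ hP ν
  obtain ⟨Δ, hdel, hKe⟩ := hK
  have hKe' : K = ((n : ℝ) - Δ) / 2 ^ (e + 1) := hKe
  have hde : ((e + 2 : ℕ) : ℝ) - 1 = (e : ℝ) + 1 := by push_cast; ring
  rw [hde] at hcond ⊢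
  have hR' : (0 : ℝ) < R := by exact_mod_cast hR
  have hdη : 0 < δ / η := by positivity
  have hKpos : 0 < K := by
    by_contra hcon
    push Not at hcon
    have : K / ((R : ℝ) * ((e : ℝ) + 1)) ≤ 0 := div_nonpos_of_nonpos_of_nonneg hcon (by positivity)
    linarith
  have hΔ : Δ < n := by
    by_contra hcon
    push Not at hcon
    have h1 : (n : ℝ) ≤ Δ := by exact_mod_cast hcon
    have : K ≤ 0 := by
      rw [hKe']
      exact div_nonpos_of_nonpos_of_nonneg (by linarith) (by positivity)
    linarith
  have hu : u Δ = K / ((R : ℝ) * ((e : ℝ) + 1)) - R - δ / η := by rw [hKe']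
  have hu1 : 1 < u Δ := by rw [hu]; linarith
  have hP0 : 0 < P := by linarith
  have hsum : Summable (fun q : ℕ => (q : ℝ) ^ (-(u Δ))) :=
    Real.summable_nat_rpow.2 (by linarith)
  have hpt : ∀ q : {q : ℕ // P ^ (τ * η) < (q : ℝ)},
      ((q.1 : ℝ) ^ n)⁻¹ * ∑ a ∈ resSet R q.1 q.1,
                ‖SgaussNu f q.1 (fun i => ((a i : ℕ) : ℤ) + 1) ν‖ ≤
      (c Δ * Ct ^ (K / ((e : ℝ) + 1)) * P ^ (-(τ * δ))) * (q.1 : ℝ) ^ (-(u Δ)) := by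
    rintro ⟨q, hq⟩
    have hPp : 0 < P ^ (τ * η) := Real.rpow_pos_of_pos hP0 _
    have hq0 : (0 : ℝ) < q := hPp.trans hq
    have hqn : 0 < q := by exact_mod_cast hq0
    refine (hc Δ hΔ f hf Ct hCt hmax hdel K hKe' q hqn ν).trans ?_
    have e1 : (R : ℝ) - K / ((R : ℝ) * ((e : ℝ) + 1)) = -(δ / η) + -(u Δ) := by rw [hu]; ring
    rw [e1, Real.rpow_add hq0, ← mul_assoc]
    have h2 : (q : ℝ) ^ (-(δ / η)) ≤ P ^ (-(τ * δ)) := by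
      have h3 : (q : ℝ) ^ (-(δ / η)) ≤ (P ^ (τ * η)) ^ (-(δ / η)) :=
        Real.rpow_le_rpow_of_nonpos hPp hq.le (by linarith)
      rw [← Real.rpow_mul hP0.le] at h3
      have e2 : τ * η * -(δ / η) = -(τ * δ) := by field_simp
      rwa [e2] at h3
    have := hc0 Δ
    gcongr
  have hsub : Summable (fun q : {q : ℕ // P ^ (τ * η) < (q : ℝ)} => (q.1 : ℝ) ^ (-(u Δ))) :=
    hsum.subtype _
  have hmaj := hsub.mul_left (c Δ * Ct ^ (K / ((e : ℝ) + 1)) * P ^ (-(τ * δ)))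
  have hsm : Summable (fun q : {q : ℕ // P ^ (τ * η) < (q : ℝ)} =>
      ((q.1 : ℝ) ^ n)⁻¹ * ∑ a ∈ resSet R q.1 q.1,
                ‖SgaussNu f q.1 (fun i => ((a i : ℕ) : ℤ) + 1) ν‖) :=
    Summable.of_nonneg_of_le (fun q => mul_nonneg (by positivity)
      (Finset.sum_nonneg fun _ _ => norm_nonneg _)) hpt hmaj
  refine (hsm.tsum_le_tsum hpt hmaj).trans ?_
  rw [tsum_mul_left]
  have h4 : ∑' q : {q : ℕ // P ^ (τ * η) < (q : ℝ)}, (q.1 : ℝ) ^ (-(u Δ)) ≤ Z Δ :=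
    Summable.tsum_subtype_le (fun q : ℕ => (q : ℝ) ^ (-(u Δ))) {q : ℕ | P ^ (τ * η) < (q : ℝ)}
      (fun q => by positivity) hsum
  have h5 : c Δ * Z Δ ≤ 1 + ∑ Δ ∈ Finset.range n, c Δ * Z Δ := by
    have := Finset.single_le_sum (f := fun Δ => c Δ * Z Δ)
      (fun Δ _ => mul_nonneg (hc0 Δ).le (hZ0 Δ)) (Finset.mem_range.2 hΔ)
    linarith
  have hCt0 : (0 : ℝ) < Ct := by linarith
  have := hc0 Δ
  calc c Δ * Ct ^ (K / ((e : ℝ) + 1)) * P ^ (-(τ * δ)) *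
        ∑' q : {q : ℕ // P ^ (τ * η) < (q : ℝ)}, (q.1 : ℝ) ^ (-(u Δ))
      ≤ c Δ * Ct ^ (K / ((e : ℝ) + 1)) * P ^ (-(τ * δ)) * Z Δ := by gcongr
    _ = (c Δ * Z Δ) * (Ct ^ (K / ((e : ℝ) + 1)) * P ^ (-(τ * δ))) := by ring
    _ ≤ (1 + ∑ Δ ∈ Finset.range n, c Δ * Z Δ) *
        (Ct ^ (K / ((e : ℝ) + 1)) * P ^ (-(τ * δ))) := by gcongr
    _ = _ := by ring

end
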